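/- arXiv:2407.16581 — 5 statements merged into one kernel-verified Lean document; each statement's English description precedes it below -/
import Mathlib

section
/- Let P be a d-tuple of vectors in ℝ_{≥0}^n, let T be an m×n stochastic matrix, and let Q := TP (i.e., q^(k) = T p^(k) for all k ∈ [d]). Then for every α ∈ A_+ and every C ⊆ [d] with supp α ⊆ C, one has Φ_{α,C}(Q) ≥ Φ_{α,C}(P). -/
open Classical

/-- **Generalized Hölder inequality** for finitely many families with weights summing to one. -/
theorem sum_prod_rpow_le_prod_rpow {ι κ : Type*} [Fintype κ] (s : Finset ι)
    (a : ι → κ → ℝ) (ha : ∀ i ∈ s, ∀ k, 0 ≤ a i k) (S : κ → ℝ) (hS : ∀ k, ∑ i ∈ s, a i k ≤ S k)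
    (α : κ → ℝ) (hα0 : ∀ k, 0 ≤ α k) (hα1 : ∑ k, α k = 1) :
    ∑ i ∈ s, ∏ k, a i k ^ α k ≤ ∏ k, S k ^ α k := by
  have hS0 : ∀ k, 0 ≤ S k := fun k =>
    (Finset.sum_nonneg fun i hi => ha i hi k).trans (hS k)
  have hprod0 : 0 ≤ ∏ k, S k ^ α k := Finset.prod_nonneg fun k _ => Real.rpow_nonneg (hS0 k) _
  have hterm : ∀ i ∈ s, ∏ k, a i k ^ α k ≤ (∑ k, α k * (a i k / S k)) * ∏ k, S k ^ α k := by
    intro i hi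
    have hfactor : ∀ k, a i k ^ α k = (a i k / S k) ^ α k * S k ^ α k := by
      intro k
      rw [← Real.mul_rpow (div_nonneg (ha i hi k) (hS0 k)) (hS0 k)]
      rcases (hS0 k).eq_or_lt with h | h
      · have : a i k ≤ S k :=
          (Finset.single_le_sum (fun i hi => ha i hi k) hi).trans (hS k)
        rw [le_antisymm (this.trans h.ge) (ha i hi k), zero_div, zero_mul]
      · rw [div_mul_cancel₀ _ h.ne']
    rw [Finset.prod_congr rfl fun k _ => hfactor k, Finset.prod_mul_distrib]
    exact mul_le_mul_of_nonneg_right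
      (Real.geom_mean_le_arith_mean_weighted _ _ _ (fun k _ => hα0 k) hα1
        fun k _ => div_nonneg (ha i hi k) (hS0 k)) hprod0
  have hsum : ∑ i ∈ s, ∑ k, α k * (a i k / S k) ≤ 1 := by
    rw [Finset.sum_comm, ← hα1]
    refine Finset.sum_le_sum fun k _ => ?_
    rw [← Finset.mul_sum, ← Finset.sum_div]
    exact mul_le_of_le_one_right (hα0 k) (div_le_one_of_le₀ (hS k) (hS0 k))
  calc ∑ i ∈ s, ∏ k, a i k ^ α k
      ≤ ∑ i ∈ s, (∑ k, α k * (a i k / S k)) * ∏ k, S k ^ α k := Finset.sum_le_sum hterm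
    _ = (∑ i ∈ s, ∑ k, α k * (a i k / S k)) * ∏ k, S k ^ α k := by rw [Finset.sum_mul]
    _ ≤ ∏ k, S k ^ α k := mul_le_of_le_one_left hprod0 hsum

/-- The weighted geometric mean is homogeneous of degree one. -/
theorem prod_mul_rpow_eq_mul_prod_rpow {κ : Type*} [Fintype κ] {t : ℝ} (ht : 0 ≤ t) {x α : κ → ℝ}
    (hx : ∀ k, 0 ≤ x k) (hα0 : ∀ k, 0 ≤ α k) (hα1 : ∑ k, α k = 1) :
    ∏ k, (t * x k) ^ α k = t * ∏ k, x k ^ α k := by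
  rw [Finset.prod_congr rfl fun k _ => Real.mul_rpow ht (hx k), Finset.prod_mul_distrib,
    ← Real.rpow_sum_of_nonneg ht fun k _ => hα0 k, hα1, Real.rpow_one]

/-- Let `P` be a `d`-tuple of vectors in `ℝ_{≥0}^n` (here `P i k` is the
`i`-th entry of the `k`-th column), let `T` be an `m × n` stochastic matrix and let
`Q = TP`, i.e. `Q j k = ∑ i, T j i * P i k`.  Then for every `α ∈ A_+` and every
`C ⊆ [d]` containing the support of `α`, one has `Φ_{α,C}(Q) ≥ Φ_{α,C}(P)`, where
`Φ_{α,C}(P) = ∑_{i ∈ I(P,C)} ∏_k (P i k) ^ (α k)` and `I(P,C) = ⋂_{c ∈ C} supp p^(c)`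
(real `rpow`, so in particular `0 ^ 0 = 1`). -/
theorem stmt0 (d n m : ℕ) (hd : 2 ≤ d)
    (P : Fin n → Fin d → ℝ) (hP : ∀ i k, 0 ≤ P i k)
    (T : Fin m → Fin n → ℝ) (hT0 : ∀ j i, 0 ≤ T j i) (hT1 : ∀ i, ∑ j, T j i = 1)
    (α : Fin d → ℝ) (hα0 : ∀ k, 0 ≤ α k) (hα1 : ∑ k, α k = 1)
    (C : Finset (Fin d)) (hC : ∀ k, 0 < α k → k ∈ C) :
    ∑ i ∈ Finset.univ.filter (fun i => ∀ c ∈ C, P i c ≠ 0), ∏ k, P i k ^ α k ≤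
      ∑ j ∈ Finset.univ.filter (fun j => ∀ c ∈ C, (∑ i, T j i * P i c) ≠ 0),
        ∏ k, (∑ i, T j i * P i k) ^ α k := by
  set I := Finset.univ.filter (fun i => ∀ c ∈ C, P i c ≠ 0)
  have hTP : ∀ j i k, 0 ≤ T j i * P i k := fun j i k => mul_nonneg (hT0 j i) (hP i k)
  have hsplit : ∑ i ∈ I, ∏ k, P i k ^ α k = ∑ j, ∑ i ∈ I, T j i * ∏ k, P i k ^ α k := by
    rw [Finset.sum_comm]
    refine Finset.sum_congr rfl fun i _ => ?_
    rw [← Finset.sum_mul, hT1, one_mul]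
  rw [hsplit, Finset.sum_filter]
  refine Finset.sum_le_sum fun j _ => ?_
  split_ifs with hj
  · rw [Finset.sum_congr rfl fun i _ =>
      (prod_mul_rpow_eq_mul_prod_rpow (hT0 j i) (hP i) hα0 hα1).symm]
    exact sum_prod_rpow_le_prod_rpow I _ (fun i _ => hTP j i) _
      (fun k => Finset.sum_le_univ_sum_of_nonneg fun i => hTP j i k) α hα0 hα1
  · push Not at hj
    obtain ⟨c, hc, hq⟩ := hj
    refine (Finset.sum_eq_zero fun i hi => ?_).le
    have hz := (Finset.sum_eq_zero_iff_of_nonneg fun i _ => hTP j i c).1 hq i (Finset.mem_univ i)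
    have hne : P i c ≠ 0 := (Finset.mem_filter.1 hi).2 c hc
    rw [(mul_eq_zero.1 hz).resolve_right hne, zero_mul]
end

section
/- Fix c ∈ [d−1] and a real α > 1. Let P be a d-tuple of vectors in ℝ_{≥0}^n with supp p^(c) ⊆ supp p^(d), let T be an m×n stochastic matrix, and let Q := TP. Then Φ_{α,c}(Q) ≤ Φ_{α,c}(P), where Φ_{α,c}(P) := Σ_{i ∈ supp p^(d)} (p_i^(c))^α (p_i^(d))^{1−α}. -/
open Classical

theorem Real.rpow_mul_rpow_one_sub {a b α : ℝ} (ha : 0 ≤ a) (hb : 0 ≤ b) (hα : 1 < α) :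
    a ^ α * b ^ (1 - α) = b * (a / b) ^ α := by
  rcases hb.eq_or_lt with rfl | hb
  · rw [Real.zero_rpow (by linarith)]
    simp
  · rw [Real.div_rpow ha hb.le, Real.rpow_sub hb, Real.rpow_one]
    ring

/-- The perspective `(a, b) ↦ a ^ α * b ^ (1 - α)` of the power function is subadditive. -/
theorem Finset.sum_rpow_mul_sum_rpow_one_sub_le {ι : Type*} (s : Finset ι) {a b : ι → ℝ} {α : ℝ}
    (hα : 1 < α) (ha : ∀ i ∈ s, 0 ≤ a i) (hb : ∀ i ∈ s, 0 ≤ b i)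
    (hab : ∀ i ∈ s, b i = 0 → a i = 0) :
    (∑ i ∈ s, a i) ^ α * (∑ i ∈ s, b i) ^ (1 - α) ≤ ∑ i ∈ s, a i ^ α * b i ^ (1 - α) := by
  rw [Real.rpow_mul_rpow_one_sub (Finset.sum_nonneg ha) (Finset.sum_nonneg hb) hα,
    Finset.sum_congr rfl fun i hi => Real.rpow_mul_rpow_one_sub (ha i hi) (hb i hi) hα]
  rcases (Finset.sum_nonneg hb).eq_or_lt with hS | hS
  · rw [← hS, zero_mul]
    exact Finset.sum_nonneg fun i hi =>
      mul_nonneg (hb i hi) (Real.rpow_nonneg (div_nonneg (ha i hi) (hb i hi)) _)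
  · have jensen := Real.rpow_arith_mean_le_arith_mean_rpow s (fun i => b i / ∑ i ∈ s, b i)
      (fun i => a i / b i) (fun i hi => div_nonneg (hb i hi) hS.le)
      (by rw [← Finset.sum_div, div_self hS.ne'])
      (fun i hi => div_nonneg (ha i hi) (hb i hi)) hα.le
    have mean : ∑ i ∈ s, b i / (∑ i ∈ s, b i) * (a i / b i) = (∑ i ∈ s, a i) / ∑ i ∈ s, b i := by
      rw [Finset.sum_div]
      refine Finset.sum_congr rfl fun i hi => ?_
      rw [div_mul_eq_mul_div, mul_div_cancel_of_imp' (hab i hi)]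
    rw [mean] at jensen
    refine (mul_le_mul_of_nonneg_left jensen hS.le).trans_eq ?_
    rw [Finset.mul_sum]
    refine Finset.sum_congr rfl fun i _ => ?_
    rw [← mul_assoc, mul_div_cancel₀ _ hS.ne']

/-- Columns are indexed by `Fin (d+1)` with `d ≥ 1` (so there are at
least two columns); the distinguished last column is `Fin.last d` and the columns
`1,…,d-1` of the paper are the `c.castSucc` for `c : Fin d`.  Fix `c` and `α > 1`.  If
`P` is a tuple of nonnegative vectors with `supp p^(c) ⊆ supp p^(d)`, `T` is stochastic
and `Q = TP`, then `Φ_{α,c}(Q) ≤ Φ_{α,c}(P)` where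
`Φ_{α,c}(P) = ∑_{i ∈ supp p^(d)} (p_i^(c))^α (p_i^(d))^{1-α}`. -/
theorem stmt1 (d n m : ℕ) (hd : 1 ≤ d) (c : Fin d) (α : ℝ) (hα : 1 < α)
    (P : Fin n → Fin (d + 1) → ℝ) (hP : ∀ i k, 0 ≤ P i k)
    (hdom : ∀ i, P i c.castSucc ≠ 0 → P i (Fin.last d) ≠ 0)
    (T : Fin m → Fin n → ℝ) (hT0 : ∀ j i, 0 ≤ T j i) (hT1 : ∀ i, ∑ j, T j i = 1) :
    ∑ j ∈ Finset.univ.filter (fun j => (∑ i, T j i * P i (Fin.last d)) ≠ 0),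
        (∑ i, T j i * P i c.castSucc) ^ α * (∑ i, T j i * P i (Fin.last d)) ^ (1 - α)
      ≤ ∑ i ∈ Finset.univ.filter (fun i => P i (Fin.last d) ≠ 0),
          P i c.castSucc ^ α * P i (Fin.last d) ^ (1 - α) := by
  have drop_filter {k : ℕ} (a b : Fin k → ℝ) :
      ∑ i ∈ Finset.univ.filter (fun i => b i ≠ 0), a i ^ α * b i ^ (1 - α) =
        ∑ i, a i ^ α * b i ^ (1 - α) := by
    refine Finset.sum_filter_of_ne fun i _ hi hbi => hi ?_
    rw [hbi, Real.zero_rpow (by linarith), mul_zero]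
  rw [drop_filter (fun j => ∑ i, T j i * P i c.castSucc) fun j => ∑ i, T j i * P i (Fin.last d),
    drop_filter (fun i => P i c.castSucc) fun i => P i (Fin.last d)]
  calc
    _ ≤ ∑ j, ∑ i, (T j i * P i c.castSucc) ^ α * (T j i * P i (Fin.last d)) ^ (1 - α) := by
      refine Finset.sum_le_sum fun j _ => Finset.sum_rpow_mul_sum_rpow_one_sub_le _ hα
        (fun i _ => mul_nonneg (hT0 j i) (hP i _)) (fun i _ => mul_nonneg (hT0 j i) (hP i _))
        fun i _ h => ?_
      rcases mul_eq_zero.mp h with h | h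
      · rw [h, zero_mul]
      · rw [not_imp_not.mp (hdom i) h, mul_zero]
    _ = ∑ j, ∑ i, T j i * (P i c.castSucc ^ α * P i (Fin.last d) ^ (1 - α)) := by
      refine Finset.sum_congr rfl fun j _ => Finset.sum_congr rfl fun i _ => ?_
      rw [Real.rpow_mul_rpow_one_sub (mul_nonneg (hT0 j i) (hP i _))
        (mul_nonneg (hT0 j i) (hP i _)) hα, Real.rpow_mul_rpow_one_sub (hP i _) (hP i _) hα]
      rcases eq_or_ne (T j i) 0 with h | h
      · simp [h]
      · rw [mul_div_mul_left _ _ h, mul_assoc]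
    _ = ∑ i, P i c.castSucc ^ α * P i (Fin.last d) ^ (1 - α) := by
      rw [Finset.sum_comm]
      exact Finset.sum_congr rfl fun i _ => by rw [← Finset.sum_mul, hT1, one_mul]
end

section
/- Let P = (p^(1),…,p^(d)) and Q = (q^(1),…,q^(d)) be d-tuples of probability vectors with ∩_{k∈[d]} supp p^(k) ≠ ∅ and ∩_{k∈[d]} supp q^(k) ≠ ∅. Suppose Φ_{α,C}(P) < Φ_{α,C}(Q) for every α ∈ A_+ and every C with supp α ⊆ C ⊆ [d] such that (α,C) is not degenerate. Then: (a) there exist a stochastic matrix T and probability vectors r^(1),…,r^(d) with ∩_{k∈[d]} supp r^(k) ≠ ∅ such that T(r^(k) ⊗ p^(k)) = r^(k) ⊗ q^(k) for all k ∈ [d]; moreover, for all sufficiently large n one may take r^(k) = (1/(n+1)) ⊕_{ℓ=0}^{n} (q^(k))^{⊗ℓ} ⊗ (p^(k))^{⊗(n−ℓ)}; (b) for all sufficiently large n there exists a stochastic matrix T_n with T_n (p^(k))^{⊗n} = (q^(k))^{⊗n} for all k ∈ [d]. Conversely, if (a) holds for some stochastic T and some probability vectors r^(1),…,r^(d) with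 ∩_{k∈[d]} supp r^(k) ≠ ∅, or (b) holds for some n ≥ 1, then Φ_{α,C}(P) ≤ Φ_{α,C}(Q) for all such pairs (α,C). -/
open Classical

noncomputable section

/-- `p` is a probability vector. -/
def IsProb {I : Type} [Fintype I] (p : I → ℝ) : Prop :=
  (∀ x, 0 ≤ p x) ∧ ∑ x, p x = 1

/-- `T` is a (column-)stochastic matrix (`T y x` is the entry in row `y`, column `x`). -/
def IsStoch {I J : Type} [Fintype I] [Fintype J] (T : J → I → ℝ) : Prop :=
  (∀ y x, 0 ≤ T y x) ∧ ∀ x, ∑ y, T y x = 1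

/-- Kronecker product of two vectors. -/
def kron {I J : Type} (p : I → ℝ) (q : J → ℝ) : I × J → ℝ := fun x => p x.1 * q x.2

/-- `n`-fold Kronecker power `p^{⊗n}`. -/
def kpow {I : Type} (p : I → ℝ) (n : ℕ) : (Fin n → I) → ℝ := fun f => ∏ j, p (f j)

/-- Index type of the catalyst `⊕_{ℓ=0}^{n} (q)^{⊗ℓ} ⊗ (p)^{⊗(n-ℓ)}`
(`I` indexes `p`, `J` indexes `q`). -/
abbrev CatIdx (I J : Type) (n : ℕ) : Type :=
  (ℓ : Fin (n + 1)) × ((Fin (ℓ : ℕ) → J) × (Fin (n - (ℓ : ℕ)) → I))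

/-- The catalyst `r = (1/(n+1)) ⊕_{ℓ=0}^{n} q^{⊗ℓ} ⊗ p^{⊗(n-ℓ)}`. -/
def catVec {I J : Type} (n : ℕ) (p : I → ℝ) (q : J → ℝ) : CatIdx I J n → ℝ :=
  fun x => (1 / (n + 1 : ℝ)) * ((∏ j, q (x.2.1 j)) * ∏ j, p (x.2.2 j))

/-- The multivariate monotone `Φ_{α,C}` (convention `0^0 = 1` of `rpow`). -/
def phiAC {I : Type} [Fintype I] (d : ℕ) (α : Fin d → ℝ) (C : Finset (Fin d))
    (p : Fin d → I → ℝ) : ℝ :=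
  ∑ x ∈ Finset.univ.filter (fun x => ∀ c ∈ C, p c x ≠ 0), ∏ k, p k x ^ α k

/-- The standard basis vector `e_k` of `ℝ^d`. -/
def stdBasis (d : ℕ) (k : Fin d) : Fin d → ℝ := fun j => if j = k then 1 else 0

/-- ℓ¹-distance of vectors. -/
def dist1 {I : Type} [Fintype I] (p q : I → ℝ) : ℝ := ∑ x, |p x - q x|

/-- The face of the standard simplex spanned by the vertices in `C`. -/
def simplexFace {κ : Type} [Fintype κ] (C : Finset κ) : Set (κ → ℝ) :=
  stdSimplex ℝ κ ∩ {α | ∀ k ∉ C, α k = 0}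

lemma isCompact_simplexFace {κ : Type} [Fintype κ] (C : Finset κ) :
    IsCompact (simplexFace C) := by
  refine (isCompact_stdSimplex ℝ κ).inter_right ?_
  simp only [Set.ofPred_forall]
  exact isClosed_iInter fun k => isClosed_iInter fun _ =>
    isClosed_eq (continuous_apply k) continuous_const

lemma single_mem_simplexFace {κ : Type} [Fintype κ] {C : Finset κ} {k : κ} (hk : k ∈ C) :
    (Pi.single k 1 : κ → ℝ) ∈ simplexFace C := by
  refine ⟨single_mem_stdSimplex ℝ k, fun j hj => ?_⟩
  have : j ≠ k := fun h => hj (h ▸ hk)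
  simp [this]

lemma convex_simplexFace {κ : Type} [Fintype κ] (C : Finset κ) : Convex ℝ (simplexFace C) := by
  refine (convex_stdSimplex ℝ κ).inter ?_
  intro x hx y hy a b _ _ _ k hk
  simp [hx k hk, hy k hk]

lemma sum_exp_neg_le {Y : Type} (s : Finset Y) (w X : Y → ℝ) (hw : ∀ y, 0 ≤ w y) {K : ℝ}
    (hX : ∀ y ∈ s, |X y| ≤ K) (t : ℝ)
    (h : ∑ y ∈ s, w y ≤ ∑ y ∈ s, w y * Real.exp (t * X y)) :
    ∑ y ∈ s, w y * Real.exp (-(t * X y)) ≤ Real.exp (t ^ 2 * K ^ 2) * ∑ y ∈ s, w y := by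
  set E := Real.exp (t ^ 2 * K ^ 2 / 2) with hE
  have hE2 : Real.exp (t ^ 2 * K ^ 2) = E ^ 2 := by
    rw [hE, ← Real.exp_nat_mul]; congr 1; push_cast; ring
  have h1 : ∑ y ∈ s, (w y * Real.exp (-(t * X y)) + w y * Real.exp (t * X y)) ≤
      ∑ y ∈ s, w y * (2 * E) := by
    refine Finset.sum_le_sum fun y hy => ?_
    rw [← mul_add]
    refine mul_le_mul_of_nonneg_left ?_ (hw y)
    have hc := Real.cosh_le_exp_half_sq (t * X y)
    rw [Real.cosh_eq] at hc
    have hsq : (X y) ^ 2 ≤ K ^ 2 := sq_le_sq' (neg_le_of_abs_le (hX y hy)) (le_of_abs_le (hX y hy))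
    have : Real.exp ((t * X y) ^ 2 / 2) ≤ E := by
      rw [hE]
      gcongr
      rw [mul_pow]
      gcongr
    linarith
  rw [Finset.sum_add_distrib, ← Finset.sum_mul] at h1
  rw [hE2]
  have hW : 0 ≤ ∑ y ∈ s, w y := Finset.sum_nonneg fun y _ => hw y
  nlinarith [mul_nonneg hW (sq_nonneg (E - 1))]

/-- Chernoff-type lower bound: the sum of `exp` of the minimum of several additive functionals on
`n`-tuples is, up to an exponential factor of arbitrarily small rate, at least its interpolation
bound at the optimal weight. -/
lemma exists_weight_le_sum_exp_inf {κ Y : Type} [Fintype κ] (C : Finset κ) (hC : C.Nonempty)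
    (s : Finset Y) (h : κ → Y → ℝ) {K : ℝ} (hK : ∀ k y, |h k y| ≤ K) :
    ∃ α ∈ simplexFace C, ∀ (n : ℕ) (t ε : ℝ), 0 ≤ t → t ≤ 1 →
      Real.exp (-(ε * n)) * (1 - C.card * Real.exp ((t ^ 2 * (2 * K) ^ 2 - t * ε) * n)) *
        (∑ y ∈ s, Real.exp (∑ k, α k * h k y)) ^ n ≤
      ∑ g ∈ Fintype.piFinset (fun _ : Fin n => s),
        Real.exp (C.inf' hC fun k => ∑ j, h k (g j)) := by
  obtain ⟨k₀, hk₀⟩ := id hC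
  have hcont : Continuous fun α : κ → ℝ => ∑ y ∈ s, Real.exp (∑ k, α k * h k y) := by fun_prop
  obtain ⟨α, hα, hmin⟩ := (isCompact_simplexFace C).exists_isMinOn
    ⟨_, single_mem_simplexFace hk₀⟩ hcont.continuousOn
  refine ⟨α, hα, fun n t ε ht0 ht1 => ?_⟩
  set m : Y → ℝ := fun y => ∑ k, α k * h k y with hm
  set w : Y → ℝ := fun y => Real.exp (m y) with hw
  set G := ∑ y ∈ s, w y with hG
  have hmK : ∀ y, |m y| ≤ K := by
    intro y
    calc |m y| ≤ ∑ k, |α k * h k y| := Finset.abs_sum_le_sum_abs _ _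
      _ ≤ ∑ k, α k * K := by
          refine Finset.sum_le_sum fun k _ => ?_
          rw [abs_mul, abs_of_nonneg (hα.1.1 k)]
          exact mul_le_mul_of_nonneg_left (hK k y) (hα.1.1 k)
      _ = K := by rw [← Finset.sum_mul, hα.1.2, one_mul]
  have htilt : ∀ k ∈ C, ∑ y ∈ s, w y * Real.exp (-(t * (h k y - m y))) ≤
      Real.exp (t ^ 2 * (2 * K) ^ 2) * G := by
    intro k hk
    refine sum_exp_neg_le s w _ (fun y => (Real.exp_pos _).le) (fun y _ => ?_) t ?_
    · calc |h k y - m y| ≤ |h k y| + |m y| := abs_sub _ _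
        _ ≤ 2 * K := by linarith [hK k y, hmK y]
    · have hmem := convex_simplexFace C hα (single_mem_simplexFace hk) (sub_nonneg.2 ht1) ht0
        (by ring)
      refine (hmin hmem).trans_eq (Finset.sum_congr rfl fun y _ => ?_)
      rw [hw, ← Real.exp_add]
      congr 1
      simp only [hm, Pi.add_apply, Pi.smul_apply, smul_eq_mul, add_mul, Finset.sum_add_distrib,
        mul_assoc, ← Finset.mul_sum, Pi.single_apply, ite_mul, one_mul, zero_mul,
        Finset.sum_ite_eq', Finset.mem_univ, if_true]
      ring
  have hpow : ∀ k ∈ C, ∑ g ∈ Fintype.piFinset (fun _ : Fin n => s),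
      ∏ j, (w (g j) * Real.exp (-(t * (h k (g j) - m (g j))))) ≤
      (Real.exp (t ^ 2 * (2 * K) ^ 2) * G) ^ n := by
    intro k hk
    rw [← Finset.prod_univ_sum (fun _ : Fin n => s)
      (fun _ y => w y * Real.exp (-(t * (h k y - m y))))]
    rw [Finset.prod_const, Finset.card_univ, Fintype.card_fin]
    exact pow_le_pow_left₀ (Finset.sum_nonneg fun y _ => by positivity) (htilt k hk) n
  have hpt : ∀ g : Fin n → Y, Real.exp (-(ε * n)) * (∏ j, w (g j) -
      ∑ k ∈ C, Real.exp (-(t * ε * n)) *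
        ∏ j, (w (g j) * Real.exp (-(t * (h k (g j) - m (g j)))))) ≤
      Real.exp (C.inf' hC fun k => ∑ j, h k (g j)) := by
    intro g
    have hwg : ∏ j, w (g j) = Real.exp (∑ j, m (g j)) := (Real.exp_sum _ _).symm
    have hterm : ∀ k, Real.exp (-(t * ε * n)) *
        ∏ j, (w (g j) * Real.exp (-(t * (h k (g j) - m (g j))))) =
        Real.exp (∑ j, m (g j)) *
          Real.exp (-(t * (∑ j, h k (g j) - ∑ j, m (g j) + ε * n))) := by
      intro k
      rw [Finset.prod_mul_distrib, hwg, ← Real.exp_sum, Finset.sum_neg_distrib, ← Finset.mul_sum,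
        Finset.sum_sub_distrib, ← Real.exp_add, ← Real.exp_add, ← Real.exp_add]
      congr 1; ring
    simp only [hterm, hwg]
    by_cases hgood : ∀ k ∈ C, ∑ j, m (g j) - ε * n ≤ ∑ j, h k (g j)
    · calc _ ≤ Real.exp (-(ε * n)) * Real.exp (∑ j, m (g j)) := by
            gcongr
            exact sub_le_self _ (Finset.sum_nonneg fun k _ => by positivity)
        _ = Real.exp (∑ j, m (g j) - ε * n) := by rw [← Real.exp_add]; congr 1; ring
        _ ≤ _ := by
            gcongr
            exact (Finset.le_inf'_iff _ _).2 hgood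
    · push Not at hgood
      obtain ⟨k, hk, hlt⟩ := hgood
      refine le_trans ?_ (Real.exp_pos _).le
      refine mul_nonpos_of_nonneg_of_nonpos (Real.exp_pos _).le (sub_nonpos.2 ?_)
      refine le_trans ?_ (Finset.single_le_sum (f := fun k => Real.exp (∑ j, m (g j)) *
          Real.exp (-(t * (∑ j, h k (g j) - ∑ j, m (g j) + ε * n))))
          (fun k _ => by positivity) hk)
      refine le_mul_of_one_le_right (Real.exp_pos _).le (Real.one_le_exp ?_)
      nlinarith
  refine le_trans ?_ (Finset.sum_le_sum fun g _ => hpt g)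
  rw [← Finset.mul_sum, Finset.sum_sub_distrib, Finset.sum_comm, mul_assoc]
  refine mul_le_mul_of_nonneg_left ?_ (Real.exp_pos _).le
  rw [← Finset.prod_univ_sum (fun _ : Fin n => s) (fun _ y => w y), Finset.prod_const,
    Finset.card_univ, Fintype.card_fin, sub_mul, one_mul, mul_assoc]
  refine sub_le_sub_left ?_ _
  rw [← nsmul_eq_mul]
  refine Finset.sum_le_card_nsmul _ _ _ fun k hk => ?_
  rw [← Finset.mul_sum]
  refine (mul_le_mul_of_nonneg_left (hpow k hk) (Real.exp_pos _).le).trans_eq ?_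
  rw [mul_pow, ← mul_assoc, ← Real.exp_nat_mul, ← Real.exp_add]
  congr 2; ring

/-- The interpolation inequality is strict uniformly over a face: finitely many weight vectors of
total mass bounded away from `1` dominate the normalised terms. -/
lemma exists_finset_weight_cover {κ I J : Type} [Fintype κ] (C : Finset κ) (hC : C.Nonempty)
    (X : Finset I) (Y : Finset J) (a : κ → I → ℝ) (b : κ → J → ℝ) (hY : Y.Nonempty)
    (hlt : ∀ α ∈ simplexFace C, ∑ x ∈ X, Real.exp (∑ k, α k * a k x) <
      ∑ y ∈ Y, Real.exp (∑ k, α k * b k y)) :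
    ∃ (S : Finset (κ → ℝ)) (v : (κ → ℝ) → I → ℝ) (ρ : ℝ), 0 < ρ ∧ ρ < 1 ∧
      (∀ σ ∈ S, (∀ x, 0 ≤ v σ x) ∧ ∑ x ∈ X, v σ x ≤ ρ) ∧
      ∀ α ∈ simplexFace C, ∃ σ ∈ S, ∀ x ∈ X,
        Real.exp (∑ k, α k * a k x) / ∑ y ∈ Y, Real.exp (∑ k, α k * b k y) ≤ v σ x := by
  obtain ⟨k₀, hk₀⟩ := id hC
  set Φ : (κ → ℝ) → ℝ := fun α => ∑ y ∈ Y, Real.exp (∑ k, α k * b k y) with hΦ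
  have hΦpos : ∀ α, 0 < Φ α := fun α => Finset.sum_pos (fun _ _ => Real.exp_pos _) hY
  have hΦc : Continuous Φ := by fun_prop
  set u : I → (κ → ℝ) → ℝ := fun x α => Real.exp (∑ k, α k * a k x) / Φ α with hu
  have huc : ∀ x, Continuous (u x) := fun x =>
    Continuous.div (by fun_prop) hΦc fun α => (hΦpos α).ne'
  have hu0 : ∀ x α, 0 < u x α := fun x α => div_pos (Real.exp_pos _) (hΦpos α)
  obtain ⟨α₀, hα₀, hmax⟩ := (isCompact_simplexFace C).exists_isMaxOn
    ⟨_, single_mem_simplexFace hk₀⟩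
    (continuous_finsetSum X fun x _ => huc x).continuousOn
  set ρ₀ := ∑ x ∈ X, u x α₀ with hρ₀
  have hρ₀0 : 0 ≤ ρ₀ := Finset.sum_nonneg fun x _ => (hu0 x α₀).le
  have hρ₀1 : ρ₀ < 1 := by
    rw [hρ₀, ← Finset.sum_div, div_lt_one (hΦpos _)]
    exact hlt α₀ hα₀
  set δ := (1 - ρ₀) / 2 / (X.card + 1) with hδ
  have hδ0 : 0 < δ := by
    have : 0 < 1 - ρ₀ := sub_pos.2 hρ₀1
    positivity
  obtain ⟨S, hS, hcover⟩ := (isCompact_simplexFace C).elim_nhds_subcover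
    (fun σ => ⋂ x ∈ X, {α | u x α < u x σ + δ}) fun σ _ => by
      refine (Filter.biInter_finset_mem X).2 fun x _ => ?_
      exact (isOpen_lt (huc x) continuous_const).mem_nhds (by simpa using hδ0)
  refine ⟨S, fun σ x => u x σ + δ, (1 + ρ₀) / 2, by linarith, by linarith, fun σ hσ =>
    ⟨fun x => (add_pos (hu0 x σ) hδ0).le, ?_⟩, fun α hα => ?_⟩
  · rw [Finset.sum_add_distrib, Finset.sum_const, nsmul_eq_mul]
    have h1 : ∑ x ∈ X, u x σ ≤ ρ₀ := hmax (hS σ hσ)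
    have h2 : (X.card : ℝ) * δ ≤ (1 - ρ₀) / 2 := by
      rw [hδ, mul_div_assoc', div_le_iff₀ (by positivity)]
      nlinarith
    linarith
  · obtain ⟨σ, hσ, hmem⟩ := Set.mem_iUnion₂.1 (hcover hα)
    exact ⟨σ, hσ, fun x hx => (Set.mem_iInter₂.1 hmem x hx).le⟩

lemma eventually_sum_inv_sum_exp_inf_le {κ I J : Type} [Fintype κ] [Fintype I] [Fintype J]
    (C : Finset κ) (hC : C.Nonempty)
    (X : Finset I) (Y : Finset J) (a : κ → I → ℝ) (b : κ → J → ℝ) (hY : Y.Nonempty)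
    (hlt : ∀ α ∈ simplexFace C, ∑ x ∈ X, Real.exp (∑ k, α k * a k x) <
      ∑ y ∈ Y, Real.exp (∑ k, α k * b k y)) {η : ℝ} (hη : 0 < η) :
    ∀ᶠ n : ℕ in Filter.atTop, ∑ f ∈ Fintype.piFinset (fun _ : Fin n => X),
      (∑ g ∈ Fintype.piFinset (fun _ : Fin n => Y),
        Real.exp (C.inf' hC fun k => ∑ j, b k (g j) - ∑ j, a k (f j)))⁻¹ ≤ η := by
  obtain ⟨S, v, ρ, hρ0, hρ1, hv, hcover⟩ := exists_finset_weight_cover C hC X Y a b hY hlt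
  set L : ℝ := ∑ k, ∑ x, |a k x| with hL
  set Lb : ℝ := ∑ k, ∑ y, |b k y| with hLb
  have haL : ∀ k x, |a k x| ≤ L := fun k x =>
    (Finset.single_le_sum (f := fun x => |a k x|) (fun _ _ => abs_nonneg _)
      (Finset.mem_univ x)).trans
    (Finset.single_le_sum (f := fun k => ∑ x, |a k x|)
      (fun _ _ => Finset.sum_nonneg fun _ _ => abs_nonneg _) (Finset.mem_univ k))
  have hbL : ∀ k y, |b k y| ≤ Lb := fun k y =>
    (Finset.single_le_sum (f := fun y => |b k y|) (fun _ _ => abs_nonneg _)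
      (Finset.mem_univ y)).trans
    (Finset.single_le_sum (f := fun k => ∑ y, |b k y|)
      (fun _ _ => Finset.sum_nonneg fun _ _ => abs_nonneg _) (Finset.mem_univ k))
  have hL0 : 0 ≤ L := Finset.sum_nonneg fun _ _ => Finset.sum_nonneg fun _ _ => abs_nonneg _
  have hLb0 : 0 ≤ Lb := Finset.sum_nonneg fun _ _ => Finset.sum_nonneg fun _ _ => abs_nonneg _
  set K := L + Lb with hK
  obtain ⟨ε, hε0, hερ⟩ : ∃ ε : ℝ, 0 < ε ∧ Real.exp ε * ρ < 1 := by
    have hlog : Real.log ρ < 0 := Real.log_neg hρ0 hρ1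
    refine ⟨-Real.log ρ / 2, by linarith, ?_⟩
    rw [← Real.exp_log hρ0, ← Real.exp_add, Real.exp_lt_one_iff, Real.log_exp]
    linarith
  obtain ⟨t, ht0, ht1, htr⟩ : ∃ t : ℝ, 0 ≤ t ∧ t ≤ 1 ∧ t ^ 2 * (2 * K) ^ 2 - t * ε < 0 := by
    refine ⟨ε / (ε + (2 * K) ^ 2 + 1), by positivity, ?_, ?_⟩
    · rw [div_le_one (by positivity)]; nlinarith [sq_nonneg (2 * K)]
    · set t := ε / (ε + (2 * K) ^ 2 + 1) with ht
      have ht0 : 0 < t := by positivity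
      have : t * (ε + (2 * K) ^ 2 + 1) = ε := div_mul_cancel₀ _ (by positivity)
      have h2 : t * (2 * K) ^ 2 < ε := by nlinarith
      nlinarith
  have hlim1 : Filter.Tendsto (fun n : ℕ => (C.card : ℝ) *
      Real.exp ((t ^ 2 * (2 * K) ^ 2 - t * ε) * n)) Filter.atTop (nhds 0) := by
    rw [← mul_zero (C.card : ℝ)]
    refine Filter.Tendsto.const_mul _ (Real.tendsto_exp_atBot.comp ?_)
    exact tendsto_natCast_atTop_atTop.const_mul_atTop_of_neg htr
  have hlim2 : Filter.Tendsto (fun n : ℕ => 2 * S.card * (Real.exp ε * ρ) ^ n) Filter.atTop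
      (nhds 0) := by
    rw [← mul_zero (2 * S.card : ℝ)]
    exact (tendsto_pow_atTop_nhds_zero_of_lt_one (by positivity) hερ).const_mul _
  filter_upwards [hlim1.eventually_le_const (show (0 : ℝ) < 1 / 2 by norm_num),
    hlim2.eventually_le_const hη, Filter.eventually_ge_atTop 1] with n hn1 hn2 hn
  have hn0 : (n : ℝ) ≠ 0 := by positivity
  refine le_trans ?_ hn2
  have hbound : ∀ f ∈ Fintype.piFinset (fun _ : Fin n => X),
      (∑ g ∈ Fintype.piFinset (fun _ : Fin n => Y),
        Real.exp (C.inf' hC fun k => ∑ j, b k (g j) - ∑ j, a k (f j)))⁻¹ ≤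
      ∑ σ ∈ S, 2 * Real.exp (ε * n) * ∏ j, v σ (f j) := by
    intro f hf
    set c : κ → ℝ := fun k => (∑ j, a k (f j)) / n with hc
    have hcn : ∀ k, n * c k = ∑ j, a k (f j) := fun k => mul_div_cancel₀ _ hn0
    have hcL : ∀ k, |c k| ≤ L := by
      intro k
      rw [hc, abs_div, Nat.abs_cast, div_le_iff₀ (by positivity)]
      refine (Finset.abs_sum_le_sum_abs _ _).trans ?_
      refine (Finset.sum_le_card_nsmul _ _ L fun j _ => haL k (f j)).trans_eq ?_
      simp [mul_comm]
    obtain ⟨α, hα, hM⟩ := exists_weight_le_sum_exp_inf C hC Y (fun k y => b k y - c k) (K := K)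
      fun k y => (abs_sub _ _).trans (by linarith [hbL k y, hcL k])
    specialize hM n t ε ht0 ht1
    simp only [Finset.sum_sub_distrib, Finset.sum_const, Finset.card_univ, Fintype.card_fin,
      nsmul_eq_mul, hcn] at hM
    set M := ∑ g ∈ Fintype.piFinset (fun _ : Fin n => Y),
        Real.exp (C.inf' hC fun k => ∑ j, b k (g j) - ∑ j, a k (f j)) with hMdef
    set Φ := ∑ y ∈ Y, Real.exp (∑ k, α k * b k y) with hΦ
    have hΦ0 : 0 < Φ := Finset.sum_pos (fun _ _ => Real.exp_pos _) hY
    have hG : (∑ y ∈ Y, Real.exp (∑ k, α k * (b k y - c k))) ^ n =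
        (∏ j, (Real.exp (∑ k, α k * a k (f j)) / Φ))⁻¹ := by
      rw [Finset.prod_div_distrib, ← Real.exp_sum, Finset.prod_const, Finset.card_univ,
        Fintype.card_fin, inv_div, Finset.sum_comm]
      simp only [← Finset.mul_sum, ← hcn, mul_sub, Finset.sum_sub_distrib, Real.exp_sub]
      rw [← Finset.sum_div, div_pow, ← Real.exp_nat_mul, Finset.mul_sum]
      congr 2
      exact Finset.sum_congr rfl fun k _ => by ring
    rw [hG] at hM
    set D := ∏ j, (Real.exp (∑ k, α k * a k (f j)) / Φ) with hD
    have hD0 : 0 < D := Finset.prod_pos fun j _ => by positivity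
    obtain ⟨σ, hσ, hσv⟩ := hcover α hα
    have hDv : D ≤ ∏ j, v σ (f j) := Finset.prod_le_prod (fun j _ => by positivity)
      fun j _ => hσv _ (Fintype.mem_piFinset.1 hf j)
    have hlow : (2 * Real.exp (ε * n) * D)⁻¹ ≤ M := by
      refine le_trans ?_ hM
      rw [mul_inv, mul_inv, mul_comm (2 : ℝ)⁻¹, ← Real.exp_neg]
      gcongr
      linarith
    have hinv : M⁻¹ ≤ 2 * Real.exp (ε * n) * D := by
      rw [← inv_inv (2 * Real.exp (ε * n) * D)]
      exact inv_anti₀ (by positivity) hlow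
    refine hinv.trans ?_
    refine le_trans ?_ (Finset.single_le_sum
      (f := fun σ => 2 * Real.exp (ε * n) * ∏ j, v σ (f j)) (fun σ hσ => ?_) hσ)
    · exact mul_le_mul_of_nonneg_left hDv (by positivity)
    · have := Finset.prod_nonneg fun (j : Fin n) (_ : j ∈ Finset.univ) => (hv σ hσ).1 (f j)
      positivity
  refine (Finset.sum_le_sum hbound).trans ?_
  have hS : 2 * S.card * (Real.exp ε * ρ) ^ n = S.card • (2 * Real.exp (ε * n) * ρ ^ n) := by
    rw [nsmul_eq_mul, mul_pow, ← Real.exp_nat_mul, mul_comm (n : ℝ)]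
    ring
  rw [Finset.sum_comm, hS]
  refine Finset.sum_le_card_nsmul _ _ _ fun σ hσ => ?_
  rw [← Finset.mul_sum, ← Finset.prod_univ_sum (fun _ : Fin n => X) (fun _ x => v σ x),
    Finset.prod_const, Finset.card_univ, Fintype.card_fin]
  have := pow_le_pow_left₀ (Finset.sum_nonneg fun x _ => (hv σ hσ).1 x) (hv σ hσ).2 n
  gcongr

/-- A partial stochastic map, defined on the rows with at least two nonzero entries and dominated by
the target, extends to a stochastic map onto the target: a row with a single nonzero entry
identifies its column and can be used to fill up the residual. -/
lemma exists_isStoch_of_dominated {κ A B : Type} [Fintype κ] [Fintype A] [Fintype B] (k₀ : κ)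
    (P : κ → A → ℝ) (Q : κ → B → ℝ) (hP : ∀ k, IsProb (P k)) (hQ : ∀ k, IsProb (Q k))
    (s : A → Finset κ) (hs : ∀ a k, k ∈ s a ↔ P k a ≠ 0)
    (T₀ : B → A → ℝ) (hT0 : ∀ b a, 0 ≤ T₀ b a)
    (hT1 : ∀ a, 2 ≤ (s a).card → ∑ b, T₀ b a = 1)
    (hdom : ∀ k b, ∑ a with 2 ≤ (s a).card, T₀ b a * P k a ≤ Q k b) :
    ∃ T : B → A → ℝ, IsStoch T ∧ ∀ k b, ∑ a, T b a * P k a = Q k b := by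
  set res : κ → B → ℝ := fun k b => Q k b - ∑ a with 2 ≤ (s a).card, T₀ b a * P k a with hres
  set w : κ → ℝ := fun k => ∑ a with ¬ 2 ≤ (s a).card, P k a with hw
  have hres0 : ∀ k b, 0 ≤ res k b := fun k b => sub_nonneg.2 (hdom k b)
  have hressum : ∀ k, ∑ b, res k b = w k := by
    intro k
    rw [hres, hw]
    simp only
    rw [Finset.sum_sub_distrib, (hQ k).2, Finset.sum_comm, ← (hP k).2,
      ← Finset.sum_filter_add_sum_filter_not Finset.univ (fun a => 2 ≤ (s a).card) (P k)]
    have : ∑ a with 2 ≤ (s a).card, ∑ b, T₀ b a * P k a = ∑ a with 2 ≤ (s a).card, P k a := by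
      refine Finset.sum_congr rfl fun a ha => ?_
      rw [← Finset.sum_mul, hT1 a (Finset.mem_filter.1 ha).2, one_mul]
    rw [this, add_sub_cancel_left]
  have hsing : ∀ k a, ¬ 2 ≤ (s a).card → P k a ≠ 0 → s a = {k} := by
    intro k a ha hk
    have hmem := (hs a k).2 hk
    have hcard : (s a).card ≤ 1 := by omega
    exact Finset.eq_singleton_iff_unique_mem.2
      ⟨hmem, fun j hj => Finset.card_le_one.1 hcard j hj k hmem⟩
  have hw0 : ∀ k a, ¬ 2 ≤ (s a).card → P k a ≠ 0 → 0 < w k := by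
    intro k a ha hk
    exact lt_of_lt_of_le (lt_of_le_of_ne ((hP k).1 a) hk.symm)
      (Finset.single_le_sum (fun a _ => (hP k).1 a)
        (Finset.mem_filter.2 ⟨Finset.mem_univ a, ha⟩))
  refine ⟨fun b a => if 2 ≤ (s a).card then T₀ b a else
    if h : ∃ k, P k a ≠ 0 then res h.choose b / w h.choose else Q k₀ b, ⟨fun b a => ?_, fun a => ?_⟩,
    fun k b => ?_⟩
  · dsimp only
    split_ifs with h1 h2
    · exact hT0 b a
    · exact div_nonneg (hres0 _ b) (hw0 _ a h1 h2.choose_spec).le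
    · exact (hQ k₀).1 b
  · dsimp only
    split_ifs with h1 h2
    · exact hT1 a h1
    · rw [← Finset.sum_div, hressum, div_self (hw0 _ a h1 h2.choose_spec).ne']
    · exact (hQ k₀).2
  · rw [← Finset.sum_filter_add_sum_filter_not Finset.univ (fun a => 2 ≤ (s a).card)]
    have h1 : ∑ a with 2 ≤ (s a).card, (if 2 ≤ (s a).card then T₀ b a else
        if h : ∃ k, P k a ≠ 0 then res h.choose b / w h.choose else Q k₀ b) * P k a =
        Q k b - res k b := by
      rw [hres, sub_sub_cancel]
      refine Finset.sum_congr rfl fun a ha => ?_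
      rw [if_pos (Finset.mem_filter.1 ha).2]
    have h2 : ∑ a with ¬ 2 ≤ (s a).card, (if 2 ≤ (s a).card then T₀ b a else
        if h : ∃ k, P k a ≠ 0 then res h.choose b / w h.choose else Q k₀ b) * P k a =
        ∑ a with ¬ 2 ≤ (s a).card, res k b / w k * P k a := by
      refine Finset.sum_congr rfl fun a ha => ?_
      have ha' := (Finset.mem_filter.1 ha).2
      rw [if_neg ha']
      by_cases hk : P k a = 0
      · rw [hk, mul_zero, mul_zero]
      · have hex : ∃ k, P k a ≠ 0 := ⟨k, hk⟩
        rw [dif_pos hex]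
        have : hex.choose = k := Finset.singleton_injective
          ((hsing _ a ha' hex.choose_spec).symm.trans (hsing k a ha' hk))
        rw [this]
    rw [h1, h2, ← Finset.mul_sum]
    change Q k b - res k b + res k b / w k * w k = Q k b
    by_cases hwk : w k = 0
    · have : res k b = 0 := (Finset.sum_eq_zero_iff_of_nonneg fun b _ => hres0 k b).1
        ((hressum k).trans hwk) b (Finset.mem_univ b)
      rw [this]; simp
    · rw [div_mul_cancel₀ _ hwk]; ring

/-- The outcomes at which every vector indexed by `C` is nonzero. -/
def commonSupp {κ I : Type} [Fintype I] (C : Finset κ) (p : κ → I → ℝ) : Finset I :=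
  Finset.univ.filter fun x => ∀ c ∈ C, p c x ≠ 0

lemma mem_commonSupp {κ I : Type} [Fintype I] {C : Finset κ} {p : κ → I → ℝ} {x : I} :
    x ∈ commonSupp C p ↔ ∀ c ∈ C, p c x ≠ 0 := by
  simp [commonSupp]

lemma phiAC_eq_sum_exp {I : Type} [Fintype I] {d : ℕ} {α : Fin d → ℝ} {C : Finset (Fin d)}
    (hα : ∀ k ∉ C, α k = 0) {p : Fin d → I → ℝ} (hp : ∀ k x, 0 ≤ p k x) :
    phiAC d α C p = ∑ x ∈ commonSupp C p, Real.exp (∑ k, α k * Real.log (p k x)) := by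
  refine Finset.sum_congr (by ext; simp [commonSupp]) fun x hx => ?_
  rw [Real.exp_sum]
  refine Finset.prod_congr rfl fun k _ => ?_
  by_cases hk : k ∈ C
  · rw [Real.rpow_def_of_pos (lt_of_le_of_ne (hp k x) (mem_commonSupp.1 hx k hk).symm), mul_comm]
  · simp [hα k hk]

lemma kpow_eq_exp {I : Type} {p : I → ℝ} (hp : ∀ x, 0 ≤ p x) {n : ℕ} {f : Fin n → I}
    (hf : ∀ j, p (f j) ≠ 0) : kpow p n f = Real.exp (∑ j, Real.log (p (f j))) := by
  rw [Real.exp_sum]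
  exact Finset.prod_congr rfl fun j _ =>
    (Real.exp_log (lt_of_le_of_ne (hp _) (hf j).symm)).symm

lemma isProb_kpow {I : Type} [Fintype I] {p : I → ℝ} (hp : IsProb p) (n : ℕ) :
    IsProb (kpow p n) := by
  refine ⟨fun f => Finset.prod_nonneg fun j _ => hp.1 _, ?_⟩
  have h := Finset.prod_univ_sum (fun _ : Fin n => (Finset.univ : Finset I)) (fun _ x => p x)
  simp only [Fintype.piFinset_univ, hp.2, Finset.prod_const_one] at h
  exact h.symm

/-- Large-sample majorization from strict inequalities of the monotones. -/
lemma eventually_exists_isStoch_kpow {I J : Type} [Fintype I] [Fintype J] (d : ℕ) (hd : 2 ≤ d)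
    (p : Fin d → I → ℝ) (q : Fin d → J → ℝ)
    (hp : ∀ k, IsProb (p k)) (hq : ∀ k, IsProb (q k)) (hqsup : ∃ y, ∀ k, q k y ≠ 0)
    (hlt : ∀ (α : Fin d → ℝ) (C : Finset (Fin d)),
        (∀ k, 0 ≤ α k) → (∑ k, α k = 1) → (∀ k, 0 < α k → k ∈ C) →
        ¬ (∃ k, α = stdBasis d k ∧ C = {k}) →
        phiAC d α C p < phiAC d α C q) :
    ∀ᶠ n : ℕ in Filter.atTop, ∃ T : (Fin n → J) → (Fin n → I) → ℝ, IsStoch T ∧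
      ∀ k g, ∑ f, T g f * kpow (p k) n f = kpow (q k) n g := by
  obtain ⟨y₀, hy₀⟩ := hqsup
  have hC : ∀ C : Finset (Fin d), 2 ≤ C.card → C.Nonempty := fun C h =>
    Finset.card_pos.1 (by omega)
  have hev : ∀ᶠ n : ℕ in Filter.atTop, ∀ (C : Finset (Fin d)) (h : 2 ≤ C.card),
      ∑ f ∈ Fintype.piFinset (fun _ : Fin n => commonSupp C p),
      (∑ g ∈ Fintype.piFinset (fun _ : Fin n => commonSupp C q),
        Real.exp (C.inf' (hC C h) fun k =>
          ∑ j, Real.log (q k (g j)) - ∑ j, Real.log (p k (f j))))⁻¹ ≤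
        1 / Fintype.card (Finset (Fin d)) := by
    rw [Filter.eventually_all]
    intro C
    by_cases h : 2 ≤ C.card
    swap
    · exact Filter.Eventually.of_forall fun n h' => absurd h' h
    refine (eventually_sum_inv_sum_exp_inf_le C (hC C h) (commonSupp C p) (commonSupp C q)
      (fun k x => Real.log (p k x)) (fun k y => Real.log (q k y))
      ⟨y₀, mem_commonSupp.2 fun k _ => hy₀ k⟩ (fun α hα => ?_)
      (η := 1 / Fintype.card (Finset (Fin d))) ?_).mono fun n hn _ => hn
    · have := hlt α C hα.1.1 hα.1.2 (fun k hk => by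
        by_contra hkC
        exact hk.ne' (hα.2 k hkC)) (by
        rintro ⟨k, -, rfl⟩
        simp at h)
      rwa [phiAC_eq_sum_exp hα.2 fun k => (hp k).1, phiAC_eq_sum_exp hα.2 fun k => (hq k).1] at this
    · have : 0 < Fintype.card (Finset (Fin d)) := Fintype.card_pos
      positivity
  filter_upwards [hev] with n hn
  set s : (Fin n → I) → Finset (Fin d) := fun f => Finset.univ.filter fun k => ∀ j, p k (f j) ≠ 0
    with hs
  have hsmem : ∀ f k, k ∈ s f ↔ ∀ j, p k (f j) ≠ 0 := fun f k => by simp [hs]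
  set E : Finset (Fin d) → (Fin n → I) → (Fin n → J) → ℝ := fun C f g =>
    if h : C.Nonempty then Real.exp (C.inf' h fun k =>
      ∑ j, Real.log (q k (g j)) - ∑ j, Real.log (p k (f j))) else 1 with hE
  have hE0 : ∀ C f g, 0 < E C f g := by
    intro C f g
    simp only [hE]
    split_ifs
    · exact Real.exp_pos _
    · exact one_pos
  set M : Finset (Fin d) → (Fin n → I) → ℝ := fun C f =>
    ∑ g ∈ Fintype.piFinset (fun _ : Fin n => commonSupp C q), E C f g with hM
  have hM0 : ∀ C f, 0 < M C f := fun C f => Finset.sum_pos (fun g _ => hE0 C f g) ⟨fun _ => y₀,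
    Fintype.mem_piFinset.2 fun _ => mem_commonSupp.2 fun k _ => hy₀ k⟩
  have hMsum : ∑ f with 2 ≤ (s f).card, (M (s f) f)⁻¹ ≤ 1 := by
    rw [← Finset.sum_fiberwise_of_maps_to (t := Finset.univ) (g := s)
      fun _ _ => Finset.mem_univ _]
    have hc : (0 : ℝ) < Fintype.card (Finset (Fin d)) := by
      exact_mod_cast (Fintype.card_pos : 0 < Fintype.card (Finset (Fin d)))
    refine (Finset.sum_le_card_nsmul _ _ (1 / (Fintype.card (Finset (Fin d)) : ℝ))
      fun C _ => ?_).trans_eq ?_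
    · by_cases h : 2 ≤ C.card
      · calc _ = ∑ f ∈ (Finset.univ.filter fun f => 2 ≤ (s f).card).filter fun f => s f = C,
              (M C f)⁻¹ := Finset.sum_congr rfl fun f hf => by rw [(Finset.mem_filter.1 hf).2]
          _ ≤ ∑ f ∈ Fintype.piFinset (fun _ : Fin n => commonSupp C p), (M C f)⁻¹ := by
              refine Finset.sum_le_sum_of_subset_of_nonneg (fun f hf => ?_)
                fun f _ _ => (inv_pos.2 (hM0 C f)).le
              have hfC := (Finset.mem_filter.1 hf).2
              exact Fintype.mem_piFinset.2 fun j => mem_commonSupp.2 fun k hk =>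
                (hsmem f k).1 (hfC ▸ hk) j
          _ ≤ _ := by
              refine le_trans (le_of_eq ?_) (hn C h)
              simp only [hM, hE, dif_pos (hC C h)]
      · rw [Finset.sum_eq_zero]
        · positivity
        · intro f hf
          simp only [Finset.mem_filter] at hf
          exact absurd (hf.2 ▸ hf.1.2) h
    · rw [nsmul_eq_mul, Finset.card_univ]
      exact mul_one_div_cancel hc.ne'
  have hpn : ∀ k, IsProb (kpow (p k) n) := fun k => isProb_kpow (hp k) n
  have hqn : ∀ k, IsProb (kpow (q k) n) := fun k => isProb_kpow (hq k) n
  have hdom : ∀ k g f, (if g ∈ Fintype.piFinset (fun _ : Fin n => commonSupp (s f) q) then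
      E (s f) f g / M (s f) f else 0) * kpow (p k) n f ≤ kpow (q k) n g * (M (s f) f)⁻¹ := by
    intro k g f
    have hnn : 0 ≤ kpow (q k) n g * (M (s f) f)⁻¹ :=
      mul_nonneg ((hqn k).1 g) (inv_pos.2 (hM0 _ f)).le
    split_ifs with hg
    swap
    · rwa [zero_mul]
    by_cases hk : k ∈ s f
    · rw [div_eq_mul_inv, mul_right_comm]
      refine mul_le_mul_of_nonneg_right ?_ (inv_pos.2 (hM0 _ f)).le
      rw [kpow_eq_exp (hp k).1 ((hsmem f k).1 hk), kpow_eq_exp (hq k).1 fun j =>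
        mem_commonSupp.1 (Fintype.mem_piFinset.1 hg j) k hk]
      simp only [hE]
      rw [dif_pos ⟨k, hk⟩, ← Real.exp_add, Real.exp_le_exp, ← le_sub_iff_add_le]
      exact Finset.inf'_le _ hk
    · have : kpow (p k) n f = 0 := by
        rw [hsmem] at hk
        push Not at hk
        obtain ⟨j, hj⟩ := hk
        exact Finset.prod_eq_zero (Finset.mem_univ j) hj
      rwa [this, mul_zero]
  refine exists_isStoch_of_dominated ⟨0, by omega⟩ (fun k => kpow (p k) n) (fun k => kpow (q k) n)
    hpn hqn s (fun f k => ?_)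
    (fun g f => if g ∈ Fintype.piFinset (fun _ : Fin n => commonSupp (s f) q) then
      E (s f) f g / M (s f) f else 0) (fun g f => ?_) (fun f _ => ?_) fun k g => ?_
  · rw [hsmem, kpow, Finset.prod_ne_zero_iff]
    simp
  · split_ifs
    · exact (div_pos (hE0 _ f g) (hM0 _ f)).le
    · exact le_rfl
  · rw [Finset.sum_ite_mem, Finset.univ_inter, ← Finset.sum_div]
    exact div_self (hM0 _ f).ne'
  · refine (Finset.sum_le_sum fun f _ => hdom k g f).trans ?_
    rw [← Finset.mul_sum]
    exact mul_le_of_le_one_right ((hqn k).1 g) hMsum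

/-- Moving one factor from the left block to the right block of a product of tuples. -/
def shiftEquiv (I J : Type) (l m : ℕ) :
    ((Fin (l + 1) → J) × (Fin m → I)) × I ≃ ((Fin l → J) × (Fin (m + 1) → I)) × J where
  toFun z := ((Fin.init z.1.1, Fin.snoc z.1.2 z.2), z.1.1 (Fin.last l))
  invFun w := ((Fin.snoc w.1.1 w.2, Fin.init w.1.2), w.1.2 (Fin.last m))
  left_inv z := by simp
  right_inv w := by simp

lemma exists_isStoch_of_equiv {κ A B : Type} [Fintype A] [Fintype B] (e : A ≃ B)
    (P : κ → A → ℝ) (Q : κ → B → ℝ) (h : ∀ k a, Q k (e a) = P k a) :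
    ∃ T : B → A → ℝ, IsStoch T ∧ ∀ k b, ∑ a, T b a * P k a = Q k b := by
  refine ⟨fun b a => if b = e a then 1 else 0, ⟨fun b a => ?_, fun a => ?_⟩, fun k b => ?_⟩
  · dsimp only
    split_ifs <;> norm_num
  · simp
  · simp only [← Equiv.symm_apply_eq, ite_mul, one_mul, zero_mul, Finset.sum_ite_eq,
      Finset.mem_univ, if_true]
    rw [← h, Equiv.apply_symm_apply]

lemma exists_isStoch_shift {κ I J : Type} [Fintype I] [Fintype J] (p : κ → I → ℝ) (q : κ → J → ℝ)
    (c : ℝ) (l m m' : ℕ) (hm : m' = m + 1) :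
    ∃ T : ((Fin l → J) × (Fin m' → I)) × J → ((Fin (l + 1) → J) × (Fin m → I)) × I → ℝ,
      IsStoch T ∧ ∀ k y, ∑ x, T y x * (c * ((∏ j, q k (x.1.1 j)) * ∏ j, p k (x.1.2 j)) * p k x.2) =
        c * ((∏ j, q k (y.1.1 j)) * ∏ j, p k (y.1.2 j)) * q k y.2 := by
  subst hm
  refine exists_isStoch_of_equiv (shiftEquiv I J l m)
    (fun k x => c * ((∏ j, q k (x.1.1 j)) * ∏ j, p k (x.1.2 j)) * p k x.2)
    (fun k y => c * ((∏ j, q k (y.1.1 j)) * ∏ j, p k (y.1.2 j)) * q k y.2) fun k x => ?_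
  simp only [shiftEquiv, Equiv.coe_fn_mk, Fin.prod_univ_castSucc, Fin.snoc_castSucc,
    Fin.snoc_last, Fin.init]
  ring

lemma exists_isStoch_transform {κ I J : Type} [Fintype I] [Fintype J] (p : κ → I → ℝ)
    (q : κ → J → ℝ) (c : ℝ) (n m : ℕ) (hm : m = 0)
    (T : (Fin (n + 1) → J) → (Fin (n + 1) → I) → ℝ) (hT : IsStoch T)
    (hTq : ∀ k g, ∑ f, T g f * kpow (p k) (n + 1) f = kpow (q k) (n + 1) g) :
    ∃ T : ((Fin n → J) × (Fin m → I)) × J → ((Fin 0 → J) × (Fin n → I)) × I → ℝ,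
      IsStoch T ∧ ∀ k y, ∑ x, T y x * (c * ((∏ j, q k (x.1.1 j)) * ∏ j, p k (x.1.2 j)) * p k x.2) =
        c * ((∏ j, q k (y.1.1 j)) * ∏ j, p k (y.1.2 j)) * q k y.2 := by
  subst hm
  let eI : ((Fin 0 → J) × (Fin n → I)) × I ≃ (Fin (n + 1) → I) :=
    { toFun := fun x => Fin.snoc x.1.2 x.2
      invFun := fun f => ((Fin.elim0, Fin.init f), f (Fin.last n))
      left_inv := fun x => by
        ext j
        · exact j.elim0
        · simp
        · simp
      right_inv := fun f => by simp }
  let eJ : ((Fin n → J) × (Fin 0 → I)) × J ≃ (Fin (n + 1) → J) :=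
    { toFun := fun x => Fin.snoc x.1.1 x.2
      invFun := fun f => ((Fin.init f, Fin.elim0), f (Fin.last n))
      left_inv := fun x => by
        ext j
        · simp
        · exact j.elim0
        · simp
      right_inv := fun f => by simp }
  refine ⟨fun y x => T (eJ y) (eI x), ⟨fun y x => hT.1 _ _, fun x => ?_⟩, fun k y => ?_⟩
  · rw [eJ.sum_comp fun g => T g (eI x)]
    exact hT.2 _
  · have hI : ∀ x, kpow (p k) (n + 1) (eI x) = (∏ j, p k (x.1.2 j)) * p k x.2 := fun x => by
      simp [eI, kpow, Fin.prod_univ_castSucc]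
    have hJ : ∀ y, kpow (q k) (n + 1) (eJ y) = (∏ j, q k (y.1.1 j)) * q k y.2 := fun y => by
      simp [eJ, kpow, Fin.prod_univ_castSucc]
    have h := hTq k (eJ y)
    rw [← eI.sum_comp fun f => T (eJ y) f * kpow (p k) (n + 1) f] at h
    simp only [hI, hJ] at h
    simp only [Finset.univ_eq_empty, Finset.prod_empty, one_mul, mul_one]
    rw [mul_assoc, ← h, Finset.mul_sum]
    exact Finset.sum_congr rfl fun x _ => by ring

lemma exists_isStoch_catVec {κ I J : Type} [Fintype I] [Fintype J] (p : κ → I → ℝ) (q : κ → J → ℝ)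
    (n : ℕ) (T : (Fin (n + 1) → J) → (Fin (n + 1) → I) → ℝ) (hT : IsStoch T)
    (hTq : ∀ k g, ∑ f, T g f * kpow (p k) (n + 1) f = kpow (q k) (n + 1) g) :
    ∃ T : CatIdx I J n × J → CatIdx I J n × I → ℝ, IsStoch T ∧
      ∀ k y, ∑ x, T y x * kron (catVec n (p k) (q k)) (p k) x
        = kron (catVec n (p k) (q k)) (q k) y := by
  set σ : Equiv.Perm (Fin (n + 1)) := (finRotate (n + 1)).symm with hσ
  have hfam : ∀ i : Fin (n + 1),
      ∃ T : ((Fin (σ i : ℕ) → J) × (Fin (n - (σ i : ℕ)) → I)) × J →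
        ((Fin (i : ℕ) → J) × (Fin (n - (i : ℕ)) → I)) × I → ℝ,
      IsStoch T ∧ ∀ k y, ∑ x, T y x *
          (1 / (n + 1 : ℝ) * ((∏ j, q k (x.1.1 j)) * ∏ j, p k (x.1.2 j)) * p k x.2) =
        1 / (n + 1 : ℝ) * ((∏ j, q k (y.1.1 j)) * ∏ j, p k (y.1.2 j)) * q k y.2 := by
    intro i
    have h0 : σ 0 = Fin.last n := by rw [hσ, Equiv.symm_apply_eq, finRotate_last]
    have hs : ∀ l : Fin n, σ l.succ = l.castSucc := fun l => by
      rw [hσ, Equiv.symm_apply_eq]; simp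
    refine Fin.cases ?_ (fun l => ?_) i
    · rw [h0]
      exact exists_isStoch_transform p q _ n _ (by simp) T hT hTq
    · rw [hs]
      exact exists_isStoch_shift p q _ l _ _ (by simp; omega)
  choose F hF hFq using hfam
  refine ⟨fun y x => if h : σ x.1.1 = y.1.1 then F x.1.1 (h ▸ y.1.2, y.2) (x.1.2, x.2) else 0,
    ⟨fun y x => ?_, fun x => ?_⟩, fun k y => ?_⟩
  · dsimp only
    split_ifs
    · exact (hF _).1 _ _
    · exact le_rfl
  · obtain ⟨⟨i, u⟩, x⟩ := x
    rw [Fintype.sum_prod_type, Fintype.sum_sigma, Finset.sum_eq_single (σ i)]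
    · rw [← (hF i).2 (u, x), Fintype.sum_prod_type]
      simp [Fintype.sum_prod_type]
    · intro b _ hb
      simp [hb.symm]
    · simp
  · obtain ⟨⟨i, u⟩, y⟩ := y
    obtain ⟨i, rfl⟩ := σ.surjective i
    rw [Fintype.sum_prod_type, Fintype.sum_sigma, Finset.sum_eq_single i]
    · have h := hFq i k (u, y)
      rw [Fintype.sum_prod_type] at h
      simpa [kron, catVec] using h
    · intro b _ hb
      simp [hb]
    · simp

lemma isProb_catVec {I J : Type} [Fintype I] [Fintype J] {p : I → ℝ} {q : J → ℝ}
    (hp : IsProb p) (hq : IsProb q) (n : ℕ) : IsProb (catVec n p q) := by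
  refine ⟨fun x => mul_nonneg (by positivity) (mul_nonneg
    (Finset.prod_nonneg fun j _ => hq.1 _) (Finset.prod_nonneg fun j _ => hp.1 _)), ?_⟩
  have h : ∀ ℓ : Fin (n + 1), ∑ u : (Fin (ℓ : ℕ) → J) × (Fin (n - (ℓ : ℕ)) → I),
      catVec n p q ⟨ℓ, u⟩ = 1 / (n + 1 : ℝ) := by
    intro ℓ
    have h1 := Fintype.sum_mul_sum (kpow q (ℓ : ℕ)) (kpow p (n - (ℓ : ℕ)))
    rw [(isProb_kpow hq _).2, (isProb_kpow hp _).2, one_mul] at h1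
    simp only [catVec]
    rw [← Finset.mul_sum, Fintype.sum_prod_type]
    exact (congrArg _ h1.symm).trans (mul_one _)
  rw [Fintype.sum_sigma, Finset.sum_congr rfl fun ℓ _ => h ℓ]
  simp
  field_simp

lemma catVec_ne_zero {I J : Type} {p : I → ℝ} {q : J → ℝ} {x : I} {y : J} (hx : p x ≠ 0)
    (hy : q y ≠ 0) (n : ℕ) : catVec n p q ⟨0, (fun _ => y, fun _ => x)⟩ ≠ 0 := by
  exact mul_ne_zero (by positivity) (mul_ne_zero (Finset.prod_ne_zero_iff.2 fun _ _ => hy)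
    (Finset.prod_ne_zero_iff.2 fun _ _ => hx))

/-- Data processing inequality for the monotones. -/
lemma phiAC_le_of_isStoch {A B : Type} [Fintype A] [Fintype B] {d : ℕ} {α : Fin d → ℝ}
    {C : Finset (Fin d)} (hα0 : ∀ k, 0 ≤ α k) (hα1 : ∑ k, α k = 1) (hαC : ∀ k, 0 < α k → k ∈ C)
    {P : Fin d → A → ℝ} {Q : Fin d → B → ℝ} (hP : ∀ k a, 0 ≤ P k a)
    {T : B → A → ℝ} (hT : IsStoch T) (hTQ : ∀ k b, ∑ a, T b a * P k a = Q k b) :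
    phiAC d α C P ≤ phiAC d α C Q := by
  have hQ : ∀ k b, 0 ≤ Q k b := fun k b => by
    rw [← hTQ]
    exact Finset.sum_nonneg fun a _ => mul_nonneg (hT.1 b a) (hP k a)
  have hαz : ∀ k ∉ C, α k = 0 := fun k hk =>
    le_antisymm (not_lt.1 fun h => hk (hαC k h)) (hα0 k)
  unfold phiAC
  have hsupp : ∀ a b, (∀ c ∈ C, P c a ≠ 0) → ¬ (∀ c ∈ C, Q c b ≠ 0) → T b a = 0 := by
    intro a b ha hb
    push Not at hb
    obtain ⟨c, hc, hcb⟩ := hb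
    rw [← hTQ] at hcb
    have := (Finset.sum_eq_zero_iff_of_nonneg fun a _ => mul_nonneg (hT.1 b a) (hP c a)).1 hcb a
      (Finset.mem_univ a)
    exact (mul_eq_zero.1 this).resolve_right (ha c hc)
  calc _ = ∑ a with ∀ c ∈ C, P c a ≠ 0, ∑ b with ∀ c ∈ C, Q c b ≠ 0, T b a * ∏ k, P k a ^ α k := by
        refine Finset.sum_congr rfl fun a ha => ?_
        rw [← Finset.sum_mul, Finset.sum_filter_of_ne, hT.2, one_mul]
        intro b _ hb
        by_contra hcon
        exact hb (hsupp a b (Finset.mem_filter.1 ha).2 hcon)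
    _ = ∑ b with ∀ c ∈ C, Q c b ≠ 0, ∑ a with ∀ c ∈ C, P c a ≠ 0, T b a * ∏ k, P k a ^ α k :=
        Finset.sum_comm
    _ ≤ _ := by
        refine Finset.sum_le_sum fun b hb => ?_
        have hb' := (Finset.mem_filter.1 hb).2
        have hQpos : ∀ k ∈ C, 0 < Q k b := fun k hk => lt_of_le_of_ne (hQ k b) (hb' k hk).symm
        have hprod : ∀ a, ∏ k, P k a ^ α k = (∏ k, Q k b ^ α k) * ∏ k, (P k a / Q k b) ^ α k := by
          intro a
          rw [← Finset.prod_mul_distrib]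
          refine Finset.prod_congr rfl fun k _ => ?_
          by_cases hk : k ∈ C
          · rw [← Real.mul_rpow (hQ k b) (div_nonneg (hP k a) (hQ k b)),
              mul_div_cancel₀ _ (hQpos k hk).ne']
          · simp [hαz k hk]
        simp only [hprod, mul_left_comm (T b _)]
        rw [← Finset.mul_sum]
        refine mul_le_of_le_one_right (Finset.prod_nonneg fun k _ => Real.rpow_nonneg (hQ k b) _) ?_
        calc _ ≤ ∑ a, T b a * ∑ k, α k * (P k a / Q k b) := by
              refine (Finset.sum_le_sum_of_subset_of_nonneg (Finset.filter_subset _ _)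
                fun a _ _ => mul_nonneg (hT.1 b a) (Finset.prod_nonneg fun k _ =>
                  Real.rpow_nonneg (div_nonneg (hP k a) (hQ k b)) _)).trans ?_
              refine Finset.sum_le_sum fun a _ => mul_le_mul_of_nonneg_left ?_ (hT.1 b a)
              exact Real.geom_mean_le_arith_mean_weighted _ _ _ (fun k _ => hα0 k) hα1
                fun k _ => div_nonneg (hP k a) (hQ k b)
          _ = ∑ k, α k * ((∑ a, T b a * P k a) / Q k b) := by
              simp only [Finset.mul_sum, Finset.sum_div]
              rw [Finset.sum_comm]
              exact Finset.sum_congr rfl fun k _ => Finset.sum_congr rfl fun a _ => by ring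
          _ ≤ ∑ k, α k := by
              refine Finset.sum_le_sum fun k _ => ?_
              rw [hTQ]
              exact mul_le_of_le_one_right (hα0 k) (div_self_le_one _)
          _ = 1 := hα1

lemma phiAC_kron {A B : Type} [Fintype A] [Fintype B] {d : ℕ} (α : Fin d → ℝ)
    (C : Finset (Fin d)) {P : Fin d → A → ℝ} {Q : Fin d → B → ℝ} (hP : ∀ k a, 0 ≤ P k a)
    (hQ : ∀ k b, 0 ≤ Q k b) :
    phiAC d α C (fun k => kron (P k) (Q k)) = phiAC d α C P * phiAC d α C Q := by
  unfold phiAC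
  rw [Finset.sum_mul_sum, ← Finset.sum_product']
  refine Finset.sum_congr ?_ fun x _ => ?_
  · ext x
    simp only [kron, Finset.mem_filter, Finset.mem_univ, true_and, Finset.mem_product,
      mul_ne_zero_iff]
    exact forall₂_and
  · rw [← Finset.prod_mul_distrib]
    exact Finset.prod_congr rfl fun k _ => Real.mul_rpow (hP k _) (hQ k _)

lemma phiAC_kpow {A : Type} [Fintype A] {d : ℕ} (α : Fin d → ℝ)
    (C : Finset (Fin d)) {P : Fin d → A → ℝ} (hP : ∀ k a, 0 ≤ P k a) (n : ℕ) :
    phiAC d α C (fun k => kpow (P k) n) = phiAC d α C P ^ n := by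
  unfold phiAC
  have h := Finset.prod_univ_sum
    (fun _ : Fin n => Finset.univ.filter fun x => ∀ c ∈ C, P c x ≠ 0)
    (fun _ x => ∏ k, P k x ^ α k)
  rw [Finset.prod_const, Finset.card_univ, Fintype.card_fin] at h
  rw [h]
  refine Finset.sum_congr ?_ fun f _ => ?_
  · ext f
    simp only [kpow, Finset.mem_filter, Finset.mem_univ, true_and, Fintype.mem_piFinset,
      Finset.prod_ne_zero_iff, forall_true_left]
    exact ⟨fun h j c hc => h c hc j, fun h c hc j => h j c hc⟩
  · rw [Finset.prod_comm]
    exact Finset.prod_congr rfl fun k _ => (Real.finsetProd_rpow _ _ (fun j _ => hP k _) _).symm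

lemma phiAC_nonneg {A : Type} [Fintype A] {d : ℕ} (α : Fin d → ℝ)
    (C : Finset (Fin d)) {P : Fin d → A → ℝ} (hP : ∀ k a, 0 ≤ P k a) : 0 ≤ phiAC d α C P :=
  Finset.sum_nonneg fun _ _ => Finset.prod_nonneg fun k _ => Real.rpow_nonneg (hP k _) _

lemma phiAC_pos {A : Type} [Fintype A] {d : ℕ} (α : Fin d → ℝ)
    (C : Finset (Fin d)) {P : Fin d → A → ℝ} (hP : ∀ k a, 0 ≤ P k a) (hsup : ∃ z, ∀ k, P k z ≠ 0) :
    0 < phiAC d α C P := by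
  obtain ⟨z, hz⟩ := hsup
  refine Finset.sum_pos' (fun _ _ => Finset.prod_nonneg fun k _ => Real.rpow_nonneg (hP k _) _)
    ⟨z, by simp [hz], ?_⟩
  exact Finset.prod_pos fun k _ => Real.rpow_pos_of_pos (lt_of_le_of_ne (hP k z) (hz k).symm) _

/-- exact large-sample / catalytic majorization, minimal
restrictions.  Let `P = (p^(1),…,p^(d))` (columns indexed over `I`) and
`Q = (q^(1),…,q^(d))` (over `J`) be `d`-tuples of probability vectors whose columns
have a common support point.  If `Φ_{α,C}(P) < Φ_{α,C}(Q)` for every nondegenerate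
pair `(α,C)` (`α ∈ A_+`, `supp α ⊆ C ⊆ [d]`, `(α,C) ≠ (e_k,{k})`), then (a) catalytic
majorization holds, with a catalyst of the explicit binomial form for all large `n`,
and (b) `P^{⊗n} ⪰ Q^{⊗n}` for all large `n`.  Conversely (a) (for any catalyst) or
(b) (for any `n ≥ 1`) implies the non-strict inequalities. -/
theorem stmt11 {I J : Type} [Fintype I] [Fintype J] (d : ℕ) (hd : 2 ≤ d)
    (p : Fin d → I → ℝ) (q : Fin d → J → ℝ)
    (hp : ∀ k, IsProb (p k)) (hq : ∀ k, IsProb (q k))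
    (hpsup : ∃ x, ∀ k, p k x ≠ 0) (hqsup : ∃ y, ∀ k, q k y ≠ 0) :
    ((∀ (α : Fin d → ℝ) (C : Finset (Fin d)),
        (∀ k, 0 ≤ α k) → (∑ k, α k = 1) → (∀ k, 0 < α k → k ∈ C) →
        ¬ (∃ k, α = stdBasis d k ∧ C = {k}) →
        phiAC d α C p < phiAC d α C q) →
      ((∃ (R : Type) (_ : Fintype R) (r : Fin d → R → ℝ),
          (∀ k, IsProb (r k)) ∧ (∃ z, ∀ k, r k z ≠ 0) ∧
          ∃ T : R × J → R × I → ℝ, IsStoch T ∧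
            ∀ k y, ∑ x, T y x * kron (r k) (p k) x = kron (r k) (q k) y) ∧
       (∃ N : ℕ, ∀ n ≥ N,
          ∃ T : CatIdx I J n × J → CatIdx I J n × I → ℝ, IsStoch T ∧
            ∀ k y, ∑ x, T y x * kron (catVec n (p k) (q k)) (p k) x
              = kron (catVec n (p k) (q k)) (q k) y) ∧
       (∃ N : ℕ, ∀ n ≥ N,
          ∃ T : (Fin n → J) → (Fin n → I) → ℝ, IsStoch T ∧
            ∀ k g, ∑ f, T g f * kpow (p k) n f = kpow (q k) n g))) ∧
    (((∃ (R : Type) (_ : Fintype R) (r : Fin d → R → ℝ),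
          (∀ k, IsProb (r k)) ∧ (∃ z, ∀ k, r k z ≠ 0) ∧
          ∃ T : R × J → R × I → ℝ, IsStoch T ∧
            ∀ k y, ∑ x, T y x * kron (r k) (p k) x = kron (r k) (q k) y) ∨
      (∃ n : ℕ, 1 ≤ n ∧
          ∃ T : (Fin n → J) → (Fin n → I) → ℝ, IsStoch T ∧
            ∀ k g, ∑ f, T g f * kpow (p k) n f = kpow (q k) n g)) →
      ∀ (α : Fin d → ℝ) (C : Finset (Fin d)),
        (∀ k, 0 ≤ α k) → (∑ k, α k = 1) → (∀ k, 0 < α k → k ∈ C) →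
        ¬ (∃ k, α = stdBasis d k ∧ C = {k}) →
        phiAC d α C p ≤ phiAC d α C q) := by

  refine ⟨fun hlt => ?_, ?_⟩
  · obtain ⟨N, hN⟩ := Filter.eventually_atTop.1
      (eventually_exists_isStoch_kpow d hd p q hp hq hqsup hlt)
    have hcat : ∀ n ≥ N, ∃ T : CatIdx I J n × J → CatIdx I J n × I → ℝ, IsStoch T ∧
        ∀ k y, ∑ x, T y x * kron (catVec n (p k) (q k)) (p k) x
          = kron (catVec n (p k) (q k)) (q k) y := by
      intro n hn
      obtain ⟨T, hT, hTq⟩ := hN (n + 1) (by omega)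
      exact exists_isStoch_catVec p q n T hT hTq
    obtain ⟨x₀, hx₀⟩ := hpsup
    obtain ⟨y₀, hy₀⟩ := hqsup
    exact ⟨⟨CatIdx I J N, inferInstance, fun k => catVec N (p k) (q k),
      fun k => isProb_catVec (hp k) (hq k) N,
      ⟨_, fun k => catVec_ne_zero (hx₀ k) (hy₀ k) N⟩, hcat N le_rfl⟩, ⟨N, hcat⟩, ⟨N, hN⟩⟩
  · have hp0 : ∀ k x, 0 ≤ p k x := fun k => (hp k).1
    have hq0 : ∀ k y, 0 ≤ q k y := fun k => (hq k).1
    rintro (⟨R, _, r, hr, hrsup, T, hT, hTq⟩ | ⟨n, hn, T, hT, hTq⟩) α C hα0 hα1 hαC -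
    · have hr0 : ∀ k z, 0 ≤ r k z := fun k => (hr k).1
      have h := phiAC_le_of_isStoch hα0 hα1 hαC (P := fun k => kron (r k) (p k))
        (fun k x => mul_nonneg (hr0 k _) (hp0 k _)) hT hTq
      rw [phiAC_kron α C hr0 hp0, phiAC_kron α C hr0 hq0] at h
      exact le_of_mul_le_mul_left h (phiAC_pos α C hr0 hrsup)
    · have h := phiAC_le_of_isStoch hα0 hα1 hαC (P := fun k => kpow (p k) n)
        (fun k x => Finset.prod_nonneg fun j _ => hp0 k _) hT hTq
      rw [phiAC_kpow α C hp0, phiAC_kpow α C hq0] at h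
      exact le_of_pow_le_pow_left₀ (by omega) (phiAC_nonneg α C hq0) h
end
end

section
/- Fix k ∈ [d] and let Δ be a monotone Φ^(k)-derivation on V^d_{d.c.} such that Δ of the single-row tuple (x,…,x) is 0 for every real x ≥ 0. If k ∈ [d−1], then there exists γ ≥ 0 such that Δ(P) = γ · Σ_{i ∈ supp p^(k)} p_i^(k) log(p_i^(k)/p_i^(d)) for all P ∈ V^d_{d.c.}. If k = d, then Δ(P) = 0 for all P ∈ V^d_{d.c.}. -/
open Classical

noncomputable section

/-- The class `V^d_{d.c.}`: tuples with `d+1 ≥ 2` columns (indexed by `Fin (d+1)`,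
with the distinguished last column `Fin.last d`), nonnegative entries, either
identically zero or with a common support point, and such that the last column
dominates the support of every other column. -/
structure Vdc (d : ℕ) where
  n : ℕ
  npos : 0 < n
  M : Fin n → Fin (d + 1) → ℝ
  nonneg : ∀ i k, 0 ≤ M i k
  mem : (∃ i, ∀ k, M i k ≠ 0) ∨ (∀ i k, M i k = 0)
  dom : ∀ (k : Fin d) (i), M i k.castSucc ≠ 0 → M i (Fin.last d) ≠ 0

namespace Vdc

variable {d : ℕ}

/-- Vertical stacking `P ⊞ Q`. -/
def boxPlus (P Q : Vdc d) : Vdc d where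
  n := P.n + Q.n
  npos := Nat.add_pos_left P.npos _
  M := Fin.append P.M Q.M
  nonneg := by
    intro i k
    induction i using Fin.addCases with
    | left i => rw [Fin.append_left]; exact P.nonneg i k
    | right i => rw [Fin.append_right]; exact Q.nonneg i k
  mem := by
    rcases P.mem with ⟨i0, hi0⟩ | hP0
    · exact Or.inl ⟨Fin.castAdd Q.n i0, fun k => by rw [Fin.append_left]; exact hi0 k⟩
    · rcases Q.mem with ⟨j0, hj0⟩ | hQ0
      · exact Or.inl ⟨Fin.natAdd P.n j0, fun k => by rw [Fin.append_right]; exact hj0 k⟩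
      · refine Or.inr fun i k => ?_
        induction i using Fin.addCases with
        | left i => rw [Fin.append_left]; exact hP0 i k
        | right i => rw [Fin.append_right]; exact hQ0 i k
  dom := by
    intro k i
    induction i using Fin.addCases with
    | left i => rw [Fin.append_left]; exact P.dom k i
    | right i => rw [Fin.append_right]; exact Q.dom k i

/-- Row-wise Kronecker product `P ⊠ Q`. -/
def boxTimes (P Q : Vdc d) : Vdc d where
  n := P.n * Q.n
  npos := Nat.mul_pos P.npos Q.npos
  M := fun i k =>
    P.M (finProdFinEquiv.symm i).1 k * Q.M (finProdFinEquiv.symm i).2 k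
  nonneg := fun i k => mul_nonneg (P.nonneg _ _) (Q.nonneg _ _)
  mem := by
    rcases P.mem with ⟨i0, hi0⟩ | hP0
    · rcases Q.mem with ⟨j0, hj0⟩ | hQ0
      · refine Or.inl ⟨finProdFinEquiv (i0, j0), fun k => ?_⟩
        simp only [Equiv.symm_apply_apply]
        exact mul_ne_zero (hi0 k) (hj0 k)
      · exact Or.inr fun i k => by simp [hQ0]
    · exact Or.inr fun i k => by simp [hP0]
  dom := fun k i h =>
    mul_ne_zero (P.dom k _ (left_ne_zero_of_mul h)) (Q.dom k _ (right_ne_zero_of_mul h))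

/-- `P ≈ Q`: equality up to permuting rows and adding/removing zero rows. -/
def approx (P Q : Vdc d) : Prop :=
  ∃ e : {i : Fin P.n // P.M i ≠ 0} ≃ {j : Fin Q.n // Q.M j ≠ 0},
    ∀ i : {i : Fin P.n // P.M i ≠ 0}, Q.M (e i).1 = P.M i.1

/-- Matrix majorization `P ⪰ Q`: `Q = T P` for a stochastic matrix `T`. -/
def maj (P Q : Vdc d) : Prop :=
  ∃ T : Fin Q.n → Fin P.n → ℝ,
    (∀ j i, 0 ≤ T j i) ∧ (∀ i, ∑ j, T j i = 1) ∧
    ∀ j k, ∑ i, T j i * P.M i k = Q.M j k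

/-- The single all-ones row. -/
def onesRow (d : ℕ) : Vdc d :=
  ⟨1, Nat.one_pos, fun _ _ => 1, fun _ _ => zero_le_one,
    Or.inl ⟨0, fun _ => one_ne_zero⟩, fun _ _ h => h⟩

/-- The single constant row `(x,…,x)` (junk value for `x < 0`). -/
def constRow (d : ℕ) (x : ℝ) : Vdc d :=
  if hx : 0 ≤ x then
    ⟨1, Nat.one_pos, fun _ _ => x, fun _ _ => hx, by
      by_cases h : x = 0
      · exact Or.inr fun _ _ => h
      · exact Or.inl ⟨0, fun _ => h⟩, fun _ _ h => h⟩
  else onesRow d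

/-- `‖p^(k)‖₁`, the sum of the entries of the `k`-th column. -/
def colSum (k : Fin (d + 1)) (P : Vdc d) : ℝ := ∑ i, P.M i k

/-- The multivariate monotone `Φ_{α,C}` (convention `0^0 = 1` of `rpow`). -/
def PhiAC (α : Fin (d + 1) → ℝ) (C : Finset (Fin (d + 1))) (P : Vdc d) : ℝ :=
  ∑ i ∈ Finset.univ.filter (fun i => ∀ c ∈ C, P.M i c ≠ 0), ∏ k, P.M i k ^ α k

/-- The dominating-column monotone `Φ_{α,c}` for `α > 1`, `c ∈ [d-1]`. -/
def PhiDC (α : ℝ) (c : Fin d) (P : Vdc d) : ℝ :=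
  ∑ i ∈ Finset.univ.filter (fun i => P.M i (Fin.last d) ≠ 0),
    P.M i c.castSucc ^ α * P.M i (Fin.last d) ^ (1 - α)

/-- `max_{i ∈ supp p^(d)} p_i^(c) / p_i^(d)` (defined as `0` if the last column
vanishes identically, which does not occur in `V^d_{d.c.}` tuples of interest). -/
def maxRatio (c : Fin d) (P : Vdc d) : ℝ :=
  if h : ∃ i, P.M i (Fin.last d) ≠ 0 then
    (Finset.univ.filter fun i => P.M i (Fin.last d) ≠ 0).sup'
      ⟨h.choose, Finset.mem_filter.mpr ⟨Finset.mem_univ _, h.choose_spec⟩⟩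
      fun i => P.M i c.castSucc / P.M i (Fin.last d)
  else 0

/-- A monotone `Φ^(k)`-derivation on `V^d_{d.c.}`. -/
def IsDeriv (k : Fin (d + 1)) (Δ : Vdc d → ℝ) : Prop :=
  (∀ P Q, approx P Q → Δ P = Δ Q) ∧
  (∀ P Q, Δ (boxPlus P Q) = Δ P + Δ Q) ∧
  (∀ P Q, Δ (boxTimes P Q) = Δ P * colSum k Q + colSum k P * Δ Q) ∧
  (∀ P Q, maj P Q → Δ Q ≤ Δ P)

/-- `m`-fold `⊠`-power (with `P^{⊠0}` the all-ones row). -/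
def boxPow (P : Vdc d) : ℕ → Vdc d
  | 0 => onesRow d
  | m + 1 => boxTimes P (boxPow P m)

/-- `U` is power universal for `V^d_{d.c.}`. -/
def PowerUniversal (U : Vdc d) : Prop :=
  ∀ P Q : Vdc d, maj P Q → ∃ m : ℕ, maj (boxTimes Q (boxPow U m)) P

/-- The standard basis vector `e_k` of `ℝ^{d+1}`. -/
def stdBasis (d : ℕ) (k : Fin (d + 1)) : Fin (d + 1) → ℝ := fun j => if j = k then 1 else 0

/-- The pairs `(α,C)` giving degenerate homomorphisms on `V^d_{d.c.}`:
`α = e_k` and `C ⊆ {k, last}`. -/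
def DegPairDC (α : Fin (d + 1) → ℝ) (C : Finset (Fin (d + 1))) : Prop :=
  ∃ k, α = stdBasis d k ∧ C ⊆ {k, Fin.last d}

end Vdc

open Vdc

namespace Vdc

variable {d : ℕ}

/-- The rows that may occur in a tuple of `V^d_{d.c.}`. -/
def ValidRow (r : Fin (d + 1) → ℝ) : Prop :=
  (∀ j, 0 ≤ r j) ∧ ∀ j, r j ≠ 0 → r (Fin.last d) ≠ 0

theorem validRow_M (P : Vdc d) (i : Fin P.n) : ValidRow (P.M i) := by
  refine ⟨P.nonneg i, fun j => ?_⟩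
  induction j using Fin.lastCases with
  | last => exact id
  | cast j => exact P.dom j i

theorem ValidRow.of_pos {r : Fin (d + 1) → ℝ} (h : ∀ j, 0 ≤ r j) (hl : 0 < r (Fin.last d)) :
    ValidRow r :=
  ⟨h, fun _ _ => hl.ne'⟩

theorem ValidRow.mul {r s : Fin (d + 1) → ℝ} (hr : ValidRow r) (hs : ValidRow s) :
    ValidRow (r * s) :=
  ⟨fun j => mul_nonneg (hr.1 j) (hs.1 j), fun j h =>
    mul_ne_zero (hr.2 j (left_ne_zero_of_mul h)) (hs.2 j (right_ne_zero_of_mul h))⟩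

theorem ValidRow.add {r s : Fin (d + 1) → ℝ} (hr : ValidRow r) (hs : ValidRow s) :
    ValidRow (r + s) := by
  refine ⟨fun j => add_nonneg (hr.1 j) (hs.1 j), fun j h h0 => h ?_⟩
  have hr0 := hr.1 (Fin.last d)
  have hs0 := hs.1 (Fin.last d)
  simp only [Pi.add_apply] at h0 ⊢
  have h1 : r j = 0 := by_contra fun hj => hr.2 j hj (by linarith)
  have h2 : s j = 0 := by_contra fun hj => hs.2 j hj (by linarith)
  rw [h1, h2, add_zero]

/-- The tuple consisting of an all-ones row followed by the given rows. -/
def augment {n : ℕ} (M : Fin n → Fin (d + 1) → ℝ) (hM : ∀ i, ValidRow (M i)) : Vdc d where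
  n := n + 1
  npos := n.succ_pos
  M := Fin.cons 1 M
  nonneg := Fin.cases (fun _ => zero_le_one) fun i => (hM i).1
  mem := Or.inl ⟨0, fun _ => one_ne_zero⟩
  dom := fun k => Fin.cases (fun _ => one_ne_zero) fun i => (hM i).2 k.castSucc

/-- The multiset of rows of a tuple. -/
def rows (P : Vdc d) : Multiset (Fin (d + 1) → ℝ) := ∑ i, {P.M i}

theorem rows_eq_map (P : Vdc d) : rows P = Finset.univ.val.map P.M := by
  rw [rows, Finset.sum_eq_multiset_sum, ← Multiset.sum_map_singleton (Finset.univ.val.map P.M),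
    Multiset.map_map]
  rfl

theorem rows_boxPlus (P Q : Vdc d) : rows (boxPlus P Q) = rows P + rows Q := by
  change ∑ i : Fin (P.n + Q.n), {Fin.append P.M Q.M i} = _
  rw [Fin.sum_univ_add]
  simp only [Fin.append_left, Fin.append_right, rows]

theorem rows_augment {n : ℕ} (M : Fin n → Fin (d + 1) → ℝ) (hM : ∀ i, ValidRow (M i)) :
    rows (augment M hM) = {1} + ∑ i, {M i} :=
  Fin.sum_univ_succ (n := n) _

theorem rows_onesRow : rows (onesRow d) = {1} := Fin.sum_univ_one _

theorem approx_of_rows_eq {P Q : Vdc d} (h : rows P = rows Q) : approx P Q := by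
  have hcard : ∀ r, Nonempty ({i // P.M i = r} ≃ {j // Q.M j = r}) := fun r => by
    rw [← Fintype.card_eq, Fintype.card_subtype, Fintype.card_subtype]
    have := congrArg (Multiset.count r) h
    rw [rows_eq_map, rows_eq_map, Multiset.count_map, Multiset.count_map] at this
    simp only [eq_comm (a := r)] at this
    simp only [Finset.card_def, Finset.filter_val]
    convert this
  let e : Fin P.n ≃ Fin Q.n := Equiv.ofFiberEquiv fun r => (hcard r).some
  have he : ∀ i, Q.M (e i) = P.M i := Equiv.ofFiberEquiv_map _
  exact ⟨e.subtypeEquiv fun i => by rw [he], fun i => he i.1⟩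

theorem sum_boxTimes (f : (Fin (d + 1) → ℝ) → ℝ) (P Q : Vdc d) :
    ∑ i, f ((boxTimes P Q).M i) = ∑ i, ∑ j, f (P.M i * Q.M j) := by
  rw [← Fintype.sum_prod_type' (f := fun i j => f (P.M i * Q.M j))]
  exact Fintype.sum_equiv finProdFinEquiv.symm _ _ fun _ => rfl

theorem sum_augment (f : (Fin (d + 1) → ℝ) → ℝ) {n : ℕ} (M : Fin n → Fin (d + 1) → ℝ)
    (hM : ∀ i, ValidRow (M i)) : ∑ i, f ((augment M hM).M i) = f 1 + ∑ i, f (M i) :=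
  Fin.sum_univ_succ (n := n) _

/-- The value of a derivation on a valid row, read off from the row stacked below all-ones. -/
def rowValue (Δ : Vdc d → ℝ) (r : Fin (d + 1) → ℝ) : ℝ :=
  if h : ValidRow r then Δ (augment ![r] fun i => by simpa using h) else 0

section Deriv

variable {k : Fin (d + 1)} {Δ : Vdc d → ℝ}

theorem apply_augment (hΔ : IsDeriv k Δ) (h1 : Δ (onesRow d) = 0) {n : ℕ}
    (M : Fin n → Fin (d + 1) → ℝ) (hM : ∀ i, ValidRow (M i)) :
    Δ (augment M hM) = ∑ i, rowValue Δ (M i) := by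
  induction n with
  | zero =>
    rw [Fin.sum_univ_zero, ← h1]
    refine hΔ.1 _ _ (approx_of_rows_eq ?_)
    rw [rows_augment, Fin.sum_univ_zero, add_zero, rows_onesRow]
  | succ n ih =>
    have key : Δ (boxPlus (augment M hM) (onesRow d)) =
        Δ (boxPlus (augment ![M 0] fun i => by simpa using hM 0)
          (augment (fun i : Fin n => M i.succ) fun i => hM _)) := by
      refine hΔ.1 _ _ (approx_of_rows_eq ?_)
      simp only [rows_boxPlus, rows_augment, rows_onesRow, Fin.sum_univ_succ,
        Finset.univ_eq_empty, Finset.sum_empty, Matrix.cons_val_zero]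
      abel
    rw [hΔ.2.1, hΔ.2.1, h1, add_zero, ih] at key
    rw [key, Fin.sum_univ_succ, rowValue, dif_pos (hM 0)]

theorem apply_eq_sum_rowValue (hΔ : IsDeriv k Δ) (h1 : Δ (onesRow d) = 0) (P : Vdc d) :
    Δ P = ∑ i, rowValue Δ (P.M i) := by
  rw [← apply_augment hΔ h1 P.M (validRow_M P), ← add_zero (Δ P), ← h1, ← hΔ.2.1]
  refine hΔ.1 _ _ (approx_of_rows_eq ?_)
  rw [rows_boxPlus, rows_augment, rows_onesRow, add_comm (rows P), rows]

theorem rowValue_one (hΔ : IsDeriv k Δ) (h1 : Δ (onesRow d) = 0) : rowValue Δ 1 = 0 := by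
  rw [apply_eq_sum_rowValue hΔ h1] at h1
  rwa [show ∑ i, rowValue Δ ((onesRow d).M i) = rowValue Δ 1 from Fin.sum_univ_one _] at h1

theorem rowValue_const (hΔ : IsDeriv k Δ) (hconst : ∀ x : ℝ, 0 ≤ x → Δ (constRow d x) = 0)
    (h1 : Δ (onesRow d) = 0) {x : ℝ} (hx : 0 ≤ x) : rowValue Δ (fun _ => x) = 0 := by
  have h := hconst x hx
  rw [apply_eq_sum_rowValue hΔ h1, constRow, dif_pos hx] at h
  simpa using h

theorem rowValue_mul (hΔ : IsDeriv k Δ) (h1 : Δ (onesRow d) = 0) {r s : Fin (d + 1) → ℝ}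
    (hr : ValidRow r) (hs : ValidRow s) :
    rowValue Δ (r * s) = rowValue Δ r * s k + r k * rowValue Δ s := by
  have h := hΔ.2.2.1 (augment ![r] fun i => by simpa using hr)
    (augment ![s] fun i => by simpa using hs)
  rw [apply_eq_sum_rowValue hΔ h1, sum_boxTimes, apply_augment hΔ h1, apply_augment hΔ h1] at h
  have hprod := sum_augment (fun t => ∑ j, rowValue Δ
    (t * (augment ![s] fun i => by simpa using hs).M j)) ![r] fun i => by simpa using hr
  have hcol (f : (Fin (d + 1) → ℝ) → ℝ) :=
    sum_augment f ![s] fun i => by simpa using hs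
  rw [hprod, hcol fun t => rowValue Δ (1 * t), colSum, colSum, hcol fun t => t k,
    sum_augment (fun t => t k) ![r]] at h
  simp only [Fin.sum_univ_one, Matrix.cons_val_zero] at h
  rw [hcol fun t => rowValue Δ (r * t)] at h
  simp [rowValue_one hΔ h1] at h
  linarith

theorem rowValue_add_le (hΔ : IsDeriv k Δ) (h1 : Δ (onesRow d) = 0) {r s : Fin (d + 1) → ℝ}
    (hr : ValidRow r) (hs : ValidRow s) :
    rowValue Δ (r + s) ≤ rowValue Δ r + rowValue Δ s := by
  have h := hΔ.2.2.2 (augment ![r, s] fun i => by fin_cases i <;> assumption)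
    (augment ![r + s] fun i => by simpa using hr.add hs) ?_
  · rw [apply_augment hΔ h1, apply_augment hΔ h1] at h
    simpa [Fin.sum_univ_succ] using h
  · refine ⟨(!![1, 0, 0; 0, 1, 1] : Matrix (Fin 2) (Fin 3) ℝ), ?_, ?_, ?_⟩
    · intro j i
      change Fin 2 at j
      change Fin 3 at i
      fin_cases j <;> fin_cases i <;> simp
    · intro i
      change Fin 3 at i
      change ∑ j : Fin 2, _ = _
      fin_cases i <;> simp [Fin.sum_univ_succ]
    · intro j k
      change Fin 2 at j
      change ∑ i : Fin 3, _ = _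
      fin_cases j <;> simp [Fin.sum_univ_succ, augment]

theorem rowValue_of_mul_self (hΔ : IsDeriv k Δ) (h1 : Δ (onesRow d) = 0)
    {r : Fin (d + 1) → ℝ} (hr : ValidRow r) (hrr : r * r = r) : rowValue Δ r = 0 := by
  have h := rowValue_mul hΔ h1 hr hr
  rw [hrr] at h
  have hk : r k * r k = r k := congrFun hrr k
  rcases IsIdempotentElem.iff_eq_zero_or_one.1 hk with h0 | h0 <;> rw [h0] at h <;> linarith

/-- The value of a row depends only on its entries in the columns `k` and `Fin.last d`. -/
theorem rowValue_congr (hΔ : IsDeriv k Δ) (h1 : Δ (onesRow d) = 0) {r s : Fin (d + 1) → ℝ}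
    (hr : ValidRow r) (hs : ValidRow s) (hk : r k = s k)
    (hl : r (Fin.last d) = s (Fin.last d)) : rowValue Δ r = rowValue Δ s := by
  set t : Fin (d + 1) → ℝ := fun j => if j = k ∨ j = Fin.last d then 1 else 0 with ht
  have htv : ValidRow t :=
    .of_pos (fun j => by simp only [ht]; split_ifs <;> norm_num) (by simp [ht])
  have ht0 : rowValue Δ t = 0 :=
    rowValue_of_mul_self hΔ h1 htv (by ext j; simp [ht])
  have htk : t k = 1 := by simp [ht]
  have hrs : t * r = t * s := by
    ext j
    by_cases hj : j = k ∨ j = Fin.last d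
    · rcases hj with rfl | rfl <;> simp [hk, hl]
    · simp [ht, hj]
  have h := rowValue_mul hΔ h1 htv hr
  rw [hrs, rowValue_mul hΔ h1 htv hs, ht0, htk] at h
  linarith

theorem rowValue_eq_last_mul (hΔ : IsDeriv k Δ)
    (hconst : ∀ x : ℝ, 0 ≤ x → Δ (constRow d x) = 0) (h1 : Δ (onesRow d) = 0)
    (hk : k ≠ Fin.last d) {r : Fin (d + 1) → ℝ} (hr : ValidRow r)
    (hl : 0 < r (Fin.last d)) :
    rowValue Δ r = r (Fin.last d) *
      rowValue Δ (Function.update 1 k (r k / r (Fin.last d))) := by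
  have hu : ValidRow (Function.update 1 k (r k / r (Fin.last d)) : Fin (d + 1) → ℝ) := by
    refine .of_pos (fun j => ?_) (by simp [hk.symm])
    rcases eq_or_ne j k with rfl | hj
    · simpa using div_nonneg (hr.1 _) hl.le
    · simp [hj]
  have hc : ValidRow (fun _ : Fin (d + 1) => r (Fin.last d)) := .of_pos (fun _ => hl.le) hl
  rw [rowValue_congr hΔ h1 hr (hc.mul hu) (by simp [mul_div_cancel₀ _ hl.ne'])
    (by simp [hk.symm]), rowValue_mul hΔ h1 hc hu, rowValue_const hΔ hconst h1 hl.le]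
  ring

end Deriv

end Vdc

/-- A real function on `[0, ∞)` obeying the product rule and nonpositive on `(0, 1)` is a
nonnegative multiple of `t log t`. -/
theorem exists_eq_mul_mul_log {h : ℝ → ℝ}
    (hmul : ∀ s t, 0 ≤ s → 0 ≤ t → h (s * t) = h s * t + s * h t)
    (hneg : ∀ t, 0 < t → t < 1 → h t ≤ 0) :
    ∃ γ : ℝ, 0 ≤ γ ∧ ∀ t, 0 ≤ t → h t = γ * (t * Real.log t) := by
  let g : ℝ →+ ℝ := AddMonoidHom.mk' (fun u => h (Real.exp u) / Real.exp u) fun a b => by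
    rw [Real.exp_add, hmul _ _ (Real.exp_pos a).le (Real.exp_pos b).le]
    field_simp
  have hg : ∀ u, g u = h (Real.exp u) / Real.exp u := fun _ => rfl
  have hpos : ∀ u, 0 ≤ u → 0 ≤ g u := by
    intro u hu
    rcases hu.eq_or_lt with rfl | hu
    · rw [map_zero]
    · rw [← neg_nonpos, ← map_neg, hg]
      exact div_nonpos_of_nonpos_of_nonneg
        (hneg _ (Real.exp_pos _) (Real.exp_lt_one_iff.2 (by linarith))) (Real.exp_pos _).le
  have hmono : Monotone g := fun a b hab => by
    have := hpos (b - a) (sub_nonneg.2 hab)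
    rw [map_sub] at this
    linarith
  have hcont : Continuous g := MeasureTheory.Measure.AddMonoidHom.continuous_of_measurable g hmono.measurable
  have hlin : ∀ u, g u = g 1 * u := fun u => by
    have := map_real_smul g hcont u 1
    simpa [mul_comm] using this
  refine ⟨g 1, hpos 1 zero_le_one, fun t ht => ?_⟩
  rcases ht.eq_or_lt with rfl | ht
  · simpa using hmul 0 0 le_rfl le_rfl
  · have := hlin (Real.log t)
    rw [hg, Real.exp_log ht, div_eq_iff ht.ne'] at this
    rw [this]
    ring

theorem Vdc.exists_rowValue_eq {d : ℕ} {k : Fin (d + 1)} {Δ : Vdc d → ℝ} (hΔ : IsDeriv k Δ)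
    (hconst : ∀ x : ℝ, 0 ≤ x → Δ (constRow d x) = 0) (h1 : Δ (onesRow d) = 0)
    (hk : k ≠ Fin.last d) :
    ∃ γ : ℝ, 0 ≤ γ ∧ ∀ r : Fin (d + 1) → ℝ, ValidRow r →
      rowValue Δ r = γ * (r k * Real.log (r k / r (Fin.last d))) := by
  have hu : ∀ t : ℝ, 0 ≤ t → ValidRow (Function.update 1 k t : Fin (d + 1) → ℝ) := by
    refine fun t ht => .of_pos (fun j => ?_) (by simp [hk.symm])
    rcases eq_or_ne j k with rfl | hj
    · simpa using ht
    · simp [hj]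
  have hzero : rowValue Δ (Function.update 1 k 0) = 0 := by
    refine rowValue_of_mul_self hΔ h1 (hu 0 le_rfl) ?_
    rw [← Function.update_mul]
    simp
  obtain ⟨γ, hγ, hlog⟩ := exists_eq_mul_mul_log
    (h := fun t => rowValue Δ (Function.update 1 k t)) (fun s t hs ht => by
      have := rowValue_mul hΔ h1 (hu s hs) (hu t ht)
      rw [← Function.update_mul] at this
      simpa using this) (fun t ht ht1 => by
      have hz : ValidRow (Function.update (fun _ => 1 - t) k 0 : Fin (d + 1) → ℝ) := by
        refine .of_pos (fun j => ?_) (by simp [hk.symm, ht1])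
        rcases eq_or_ne j k with rfl | hj
        · simp
        · simp [hj, ht1.le]
      have hz0 := rowValue_eq_last_mul hΔ hconst h1 hk hz (by simp [hk.symm, ht1])
      have hadd := rowValue_add_le hΔ h1 (.of_pos (fun _ => ht.le) ht) hz
      rw [rowValue_const hΔ hconst h1 ht.le, hz0] at hadd
      simp only [Function.update_self, zero_div, hzero, mul_zero, add_zero] at hadd
      convert hadd using 2
      ext j
      rcases eq_or_ne j k with rfl | hj
      · simp
      · simp [hj])
  refine ⟨γ, hγ, fun r hr => ?_⟩
  rcases (hr.1 (Fin.last d)).eq_or_lt with hl | hl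
  · have h0 : ∀ j, r j = 0 := fun j => by_contra fun hj => hr.2 j hj hl.symm
    rw [rowValue_of_mul_self hΔ h1 hr (by ext j; simp [h0]), h0 k]
    simp
  · rw [rowValue_eq_last_mul hΔ hconst h1 hk hr hl, hlog _ (div_nonneg (hr.1 k) hl.le)]
    field_simp

/-- Fix a column `k` (of the `d+1` columns; the paper's `[d-1]`
corresponds to `k ≠ Fin.last d`) and let `Δ` be a monotone `Φ^(k)`-derivation on
`V^d_{d.c.}` vanishing on all constant single rows `(x,…,x)`, `x ≥ 0`.  If `k` is not
the last column then `Δ(P) = γ ∑_{i ∈ supp p^(k)} p_i^(k) log(p_i^(k)/p_i^(d))` for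
some `γ ≥ 0`; if `k` is the last column then `Δ = 0`. -/
theorem stmt13 (d : ℕ) (hd : 1 ≤ d) (k : Fin (d + 1)) (Δ : Vdc d → ℝ)
    (hΔ : IsDeriv k Δ)
    (hconst : ∀ x : ℝ, 0 ≤ x → Δ (constRow d x) = 0) :
    (k ≠ Fin.last d →
      ∃ γ : ℝ, 0 ≤ γ ∧ ∀ P : Vdc d,
        Δ P = γ * ∑ i ∈ Finset.univ.filter (fun i => P.M i k ≠ 0),
          P.M i k * Real.log (P.M i k / P.M i (Fin.last d))) ∧
    (k = Fin.last d → ∀ P : Vdc d, Δ P = 0) := by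
  have h1 : Δ (onesRow d) = 0 := by simpa [constRow, onesRow] using hconst 1 zero_le_one
  refine ⟨fun hk => ?_, ?_⟩
  · obtain ⟨γ, hγ, hval⟩ := exists_rowValue_eq hΔ hconst h1 hk
    refine ⟨γ, hγ, fun P => ?_⟩
    rw [apply_eq_sum_rowValue hΔ h1, Finset.mul_sum, Finset.sum_filter]
    refine Finset.sum_congr rfl fun i _ => ?_
    rw [hval _ (validRow_M P i)]
    split_ifs with hi
    · rfl
    · simp [not_not.1 hi]
  · rintro rfl P
    rw [apply_eq_sum_rowValue hΔ h1]
    refine Finset.sum_eq_zero fun i _ => ?_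
    have hl := P.nonneg i (Fin.last d)
    rw [← rowValue_const hΔ hconst h1 hl]
    exact rowValue_congr hΔ h1 (validRow_M P i) ⟨fun _ => hl, fun _ h => h⟩ rfl rfl
end
end

section
/- Let U = (u^(1),…,u^(d)) ∈ V^d_{d.c.} have probability-vector columns. Then the following are equivalent: (i) U is power universal for V^d_{d.c.}; (ii) supp u^(k) ⊊ supp u^(d) for all k ∈ [d−1], and supp u^(k) ⊄ supp u^(k′) for all k, k′ ∈ [d−1] with k ≠ k′; (iii) every nondegenerate monotone homomorphism takes a value different from 1 at U, i.e.: Φ_{α,C}(U) ≠ 1 for every α ∈ A_+ and supp α ⊆ C ⊆ [d] with (α,C) not degenerate on V^d_{d.c.}; Φ_{α,c}(U) ≠ 1 for every c ∈ [d−1] and every real α > 1; and max_{i ∈ supp u^(d)} u_i^(c)/u_i^(d) ≠ 1 for every c ∈ [d−1]. -/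
open Classical

noncomputable section

open Vdc

namespace Vdc

variable {d : ℕ}

/-- The mass of column `a` on the support of column `b`. -/
def crossMass (a b : Fin (d + 1)) (P : Vdc d) : ℝ :=
  ∑ i, if P.M i b ≠ 0 then P.M i a else 0

/-- No column has its support contained in that of a different, non-last column. -/
def SuppSeparated (U : Vdc d) : Prop :=
  ∀ a b : Fin (d + 1), b ≠ Fin.last d → a ≠ b → ∃ i, U.M i a ≠ 0 ∧ U.M i b = 0

/-- Row `i` meets the support of some non-last column different from `a`. -/
def IsMixed (P : Vdc d) (a : Fin (d + 1)) (i : Fin P.n) : Prop :=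
  ∃ b : Fin d, b.castSucc ≠ a ∧ P.M i b.castSucc ≠ 0

/-- The mass of column `a` on the rows meeting the support of another non-last column. -/
def mixedMass (a : Fin (d + 1)) (P : Vdc d) : ℝ :=
  ∑ i, if P.IsMixed a i then P.M i a else 0

theorem crossMass_self (a : Fin (d + 1)) (P : Vdc d) : crossMass a a P = ∑ i, P.M i a := by
  refine Finset.sum_congr rfl fun i _ => ?_
  split_ifs with h
  · rfl
  · exact (not_not.mp h).symm

theorem crossMass_nonneg (a b : Fin (d + 1)) (P : Vdc d) : 0 ≤ crossMass a b P :=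
  Finset.sum_nonneg fun i _ => by split_ifs <;> simp [P.nonneg]

theorem crossMass_boxTimes (a b : Fin (d + 1)) (P Q : Vdc d) :
    crossMass a b (boxTimes P Q) = crossMass a b P * crossMass a b Q := by
  have h : ∀ x y x' y' : ℝ, (if x * y ≠ 0 then x' * y' else 0)
      = (if x ≠ 0 then x' else 0) * (if y ≠ 0 then y' else 0) := fun x y x' y' => by
    by_cases hx : x = 0 <;> by_cases hy : y = 0 <;> simp [hx, hy]
  unfold crossMass
  rw [Finset.sum_mul_sum, ← Finset.sum_product', Finset.univ_product_univ]
  exact Fintype.sum_equiv finProdFinEquiv.symm _ _ fun i => h _ _ _ _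

theorem crossMass_boxPow (a b : Fin (d + 1)) (P : Vdc d) (m : ℕ) :
    crossMass a b (boxPow P m) = crossMass a b P ^ m := by
  induction m with
  | zero =>
    simp only [boxPow, crossMass, onesRow, ne_eq, one_ne_zero, not_false_eq_true, if_true, pow_zero]
    exact Fin.sum_univ_one _
  | succ m ih => rw [boxPow, crossMass_boxTimes, ih, pow_succ']

theorem sum_boxTimes_boxPow {U : Vdc d} (hU : ∀ k, ∑ i, U.M i k = 1) (Q : Vdc d) (m : ℕ)
    (k : Fin (d + 1)) : ∑ i, (boxTimes Q (boxPow U m)).M i k = ∑ i, Q.M i k := by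
  rw [← crossMass_self, crossMass_boxTimes, crossMass_boxPow, crossMass_self, crossMass_self, hU,
    one_pow, mul_one]

theorem maj.sum_eq {P Q : Vdc d} (h : maj P Q) (k : Fin (d + 1)) :
    ∑ j, Q.M j k = ∑ i, P.M i k := by
  obtain ⟨T, -, hT1, hT⟩ := h
  simp_rw [← hT]
  rw [Finset.sum_comm]
  simp_rw [← Finset.sum_mul, hT1, one_mul]

theorem maj.crossMass_le {P Q : Vdc d} (h : maj P Q) (a b : Fin (d + 1)) :
    crossMass a b P ≤ crossMass a b Q := by
  obtain ⟨T, hT0, hT1, hT⟩ := h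
  have hQ : crossMass a b Q = ∑ i, ∑ j, if Q.M j b ≠ 0 then T j i * P.M i a else 0 := by
    rw [Finset.sum_comm]
    refine Finset.sum_congr rfl fun j _ => ?_
    split_ifs with hj
    · exact (hT j a).symm
    · simp
  rw [hQ]
  refine Finset.sum_le_sum fun i _ => ?_
  split_ifs with hi
  · have hP : P.M i a = ∑ j, T j i * P.M i a := by rw [← Finset.sum_mul, hT1, one_mul]
    refine hP.le.trans ?_
    refine Finset.sum_le_sum fun j _ => ?_
    split_ifs with hj
    · exact le_rfl
    · rw [not_not, ← hT, Finset.sum_eq_zero_iff_of_nonneg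
        fun i _ => mul_nonneg (hT0 j i) (P.nonneg i b)] at hj
      have := hj i (Finset.mem_univ i)
      simp [(mul_eq_zero.mp this).resolve_right hi]
  · exact Finset.sum_nonneg fun j _ => by
      split_ifs
      · exact mul_nonneg (hT0 j i) (P.nonneg i a)
      · exact le_rfl

theorem crossMass_lt_one {U : Vdc d} (hU : ∀ k, ∑ i, U.M i k = 1) {a b : Fin (d + 1)}
    (h : ∃ i, U.M i a ≠ 0 ∧ U.M i b = 0) : crossMass a b U < 1 := by
  obtain ⟨i, hia, hib⟩ := h
  rw [← hU a]
  refine Finset.sum_lt_sum (fun j _ => ?_) ⟨i, Finset.mem_univ i, ?_⟩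
  · split_ifs
    exacts [le_rfl, U.nonneg j a]
  · simpa [hib] using lt_of_le_of_ne (U.nonneg i a) (Ne.symm hia)

theorem crossMass_eq_one {U : Vdc d} (hU : ∀ k, ∑ i, U.M i k = 1) {a b : Fin (d + 1)}
    (h : ¬ ∃ i, U.M i a ≠ 0 ∧ U.M i b = 0) : crossMass a b U = 1 := by
  push Not at h
  rw [← hU a]
  refine Finset.sum_congr rfl fun i _ => ?_
  split_ifs with hi
  · rfl
  · by_contra hne
    exact hi (h i (Ne.symm hne))

theorem mixedMass_le (a : Fin (d + 1)) (P : Vdc d) :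
    mixedMass a P ≤ ∑ b : Fin d, if b.castSucc ≠ a then crossMass a b.castSucc P else 0 := by
  have hr : (∑ b : Fin d, if b.castSucc ≠ a then crossMass a b.castSucc P else 0)
      = ∑ i, ∑ b : Fin d, if b.castSucc ≠ a ∧ P.M i b.castSucc ≠ 0 then P.M i a else 0 := by
    rw [Finset.sum_comm]
    refine Finset.sum_congr rfl fun b _ => ?_
    by_cases hb : b.castSucc = a <;> simp [hb, crossMass]
  rw [hr]
  refine Finset.sum_le_sum fun i _ => ?_
  have h0 : ∀ b ∈ (Finset.univ : Finset (Fin d)),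
      0 ≤ if b.castSucc ≠ a ∧ P.M i b.castSucc ≠ 0 then P.M i a else 0 := fun b _ => by
    split_ifs
    exacts [P.nonneg i a, le_rfl]
  split_ifs with h
  · obtain ⟨b, hb⟩ := h
    refine le_trans ?_ (Finset.single_le_sum h0 (Finset.mem_univ b))
    rw [if_pos hb]
  · exact Finset.sum_nonneg h0

theorem tendsto_mixedMass {U : Vdc d} (hU : ∀ k, ∑ i, U.M i k = 1) (hs : SuppSeparated U)
    (Q : Vdc d) (a : Fin (d + 1)) :
    Filter.Tendsto (fun m => mixedMass a (boxTimes Q (boxPow U m))) Filter.atTop (nhds 0) := by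
  refine squeeze_zero (fun m => Finset.sum_nonneg fun i _ => ?_) (fun m => mixedMass_le a _) ?_
  · split_ifs
    exacts [nonneg _ i a, le_rfl]
  · rw [← Finset.sum_const_zero (s := (Finset.univ : Finset (Fin d)))]
    refine tendsto_finsetSum _ fun b _ => ?_
    by_cases hb : b.castSucc = a
    · simp [hb]
    · have hlt := crossMass_lt_one hU (hs a b.castSucc (Fin.castSucc_lt_last b).ne (Ne.symm hb))
      simp only [ne_eq, hb, not_false_eq_true, if_true, crossMass_boxTimes, crossMass_boxPow]
      simpa using (tendsto_pow_atTop_nhds_zero_of_lt_one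
        (crossMass_nonneg a b.castSucc U) hlt).const_mul (crossMass a b.castSucc Q)

theorem sum_not_isMixed (a : Fin (d + 1)) (W : Vdc d) :
    (∑ r, if W.IsMixed a r then 0 else W.M r a) = ∑ r, W.M r a - mixedMass a W := by
  rw [mixedMass, ← Finset.sum_sub_distrib]
  refine Finset.sum_congr rfl fun r _ => ?_
  split_ifs <;> simp

theorem maj_of_mixedMass_lt {W P : Vdc d} (hsum : ∀ k, ∑ r, W.M r k = ∑ j, P.M j k)
    {i₀ : Fin P.n} (h₀ : ∀ k, P.M i₀ k ≠ 0)
    (hlt : ∀ a j, P.M j a ≠ 0 → mixedMass a W < P.M j a) : maj W P := by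
  have hq : ∀ a, 0 < ∑ j, P.M j a - mixedMass a W := fun a => by
    have h1 := hlt a i₀ (h₀ a)
    have h2 := Finset.single_le_sum (fun j _ => P.nonneg j a) (Finset.mem_univ i₀)
    linarith
  -- the point mass at `i₀`, and the distributions assigned to rows meeting one column only
  let δ : Fin P.n → ℝ := fun j => if j = i₀ then 1 else 0
  have hδ0 : ∀ j, 0 ≤ δ j := fun j => by dsimp only [δ]; split_ifs <;> norm_num
  have hδ1 : ∑ j, δ j = 1 := by simp [δ]
  have hδs : ∀ j, P.M j (Fin.last d) = 0 → δ j = 0 := fun j hj =>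
    if_neg fun h => h₀ _ (h ▸ hj)
  let t : Fin d → Fin P.n → ℝ := fun k j =>
    (P.M j k.castSucc - mixedMass k.castSucc W * δ j) /
      (∑ j, P.M j k.castSucc - mixedMass k.castSucc W)
  have ht0 : ∀ k j, 0 ≤ t k j := fun k j => by
    refine div_nonneg ?_ (hq _).le
    by_cases hj : j = i₀
    · have := hlt k.castSucc j (hj ▸ h₀ _)
      simp only [δ, hj, if_true] at this ⊢
      linarith
    · simp [δ, hj, P.nonneg]
  have ht1 : ∀ k, ∑ j, t k j = 1 := fun k => by
    dsimp only [t]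
    rw [← Finset.sum_div, Finset.sum_sub_distrib, ← Finset.mul_sum, hδ1, mul_one]
    exact div_self (hq _).ne'
  have hts : ∀ k j, P.M j (Fin.last d) = 0 → t k j = 0 := fun k j hj => by
    have : P.M j k.castSucc = 0 := by
      by_contra h
      exact P.dom k j h hj
    simp [t, this, hδs j hj]
  let V : Fin P.n → Fin W.n → ℝ := fun j r =>
    if h : ∃ k : Fin d, W.M r k.castSucc ≠ 0 ∧ ¬ W.IsMixed k.castSucc r then t h.choose j else δ j
  have hV0 : ∀ j r, 0 ≤ V j r := fun j r => by
    dsimp only [V]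
    split_ifs
    exacts [ht0 _ j, hδ0 j]
  have hV1 : ∀ r, ∑ j, V j r = 1 := fun r => by
    dsimp only [V]
    split_ifs
    exacts [ht1 _, hδ1]
  have hVs : ∀ j r, P.M j (Fin.last d) = 0 → V j r = 0 := fun j r hj => by
    dsimp only [V]
    split_ifs
    exacts [hts _ j hj, hδs j hj]
  have hVle : ∀ j r, V j r ≤ 1 := fun j r =>
    hV1 r ▸ Finset.single_le_sum (fun j _ => hV0 j r) (Finset.mem_univ j)
  let L : Fin P.n → ℝ := fun j =>
    ∑ r, if W.IsMixed (Fin.last d) r then V j r * W.M r (Fin.last d) else 0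
  have hLle : ∀ j, L j ≤ P.M j (Fin.last d) := fun j => by
    by_cases hj : P.M j (Fin.last d) = 0
    · simp [L, hVs j _ hj, hj]
    · refine le_trans (Finset.sum_le_sum fun r _ => ?_) (hlt _ j hj).le
      split_ifs
      exacts [mul_le_of_le_one_left (W.nonneg r _) (hVle j r), le_rfl]
  have hL1 : ∑ j, L j = mixedMass (Fin.last d) W := by
    dsimp only [L, mixedMass]
    rw [Finset.sum_comm]
    refine Finset.sum_congr rfl fun r _ => ?_
    split_ifs
    · rw [← Finset.sum_mul, hV1, one_mul]
    · simp
  let s : Fin P.n → ℝ := fun j =>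
    (P.M j (Fin.last d) - L j) / (∑ j, P.M j (Fin.last d) - mixedMass (Fin.last d) W)
  have hs1 : ∑ j, s j = 1 := by
    dsimp only [s]
    rw [← Finset.sum_div, Finset.sum_sub_distrib, hL1]
    exact div_self (hq _).ne'
  refine ⟨fun j r => if W.IsMixed (Fin.last d) r then V j r else s j, fun j r => ?_, fun r => ?_,
    fun j k => ?_⟩
  · dsimp only
    split_ifs
    exacts [hV0 j r, div_nonneg (sub_nonneg.mpr (hLle j)) (hq _).le]
  · dsimp only
    split_ifs
    exacts [hV1 r, hs1]
  · induction k using Fin.lastCases with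
    | last =>
      have : ∀ r, (if W.IsMixed (Fin.last d) r then V j r else s j) * W.M r (Fin.last d)
          = (if W.IsMixed (Fin.last d) r then V j r * W.M r (Fin.last d) else 0)
            + s j * (if W.IsMixed (Fin.last d) r then 0 else W.M r (Fin.last d)) := fun r => by
        split_ifs <;> simp
      simp_rw [this]
      rw [Finset.sum_add_distrib, ← Finset.mul_sum, sum_not_isMixed, hsum,
        div_mul_cancel₀ _ (hq _).ne']
      exact add_sub_cancel _ _
    | cast k =>
      have : ∀ r, (if W.IsMixed (Fin.last d) r then V j r else s j) * W.M r k.castSucc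
          = δ j * (if W.IsMixed k.castSucc r then W.M r k.castSucc else 0)
            + t k j * (if W.IsMixed k.castSucc r then 0 else W.M r k.castSucc) := fun r => by
        by_cases hr : W.M r k.castSucc = 0
        · simp [hr]
        have huniq : ∀ k' : Fin d, ¬ W.IsMixed k'.castSucc r → k' = k := fun k' hk' => by
          by_contra hne
          exact hk' ⟨k, fun h => hne (Fin.castSucc_injective d h).symm, hr⟩
        have hml : W.IsMixed (Fin.last d) r := ⟨k, (Fin.castSucc_lt_last k).ne, hr⟩
        rw [if_pos hml]
        by_cases hm : W.IsMixed k.castSucc r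
        · have hn : ¬ ∃ k : Fin d, W.M r k.castSucc ≠ 0 ∧ ¬ W.IsMixed k.castSucc r :=
            fun ⟨k', _, hk'⟩ => hk' (huniq k' hk' ▸ hm)
          simp [V, hn, hm]
        · have hn : ∃ k : Fin d, W.M r k.castSucc ≠ 0 ∧ ¬ W.IsMixed k.castSucc r := ⟨k, hr, hm⟩
          simp only [V, dif_pos hn, if_neg hm, huniq _ hn.choose_spec.2, mul_zero, zero_add]
      simp_rw [this]
      rw [Finset.sum_add_distrib, ← Finset.mul_sum, ← Finset.mul_sum, sum_not_isMixed, hsum,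
        div_mul_cancel₀ _ (hq _).ne', ← mixedMass]
      ring

theorem SuppSeparated.powerUniversal {U : Vdc d} (hU : ∀ k, ∑ i, U.M i k = 1)
    (hs : SuppSeparated U) : PowerUniversal U := by
  intro P Q hPQ
  rcases P.mem with ⟨i₀, h₀⟩ | hP
  · have hev : ∀ᶠ m in Filter.atTop, ∀ a j, P.M j a ≠ 0 →
        mixedMass a (boxTimes Q (boxPow U m)) < P.M j a := by
      simp only [Filter.eventually_all]
      exact fun a j hj => (tendsto_mixedMass hU hs Q a).eventually_lt_const
        (lt_of_le_of_ne (P.nonneg j a) (Ne.symm hj))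
    obtain ⟨m, hm⟩ := hev.exists
    exact ⟨m, maj_of_mixedMass_lt
      (fun k => (sum_boxTimes_boxPow hU Q m k).trans (hPQ.sum_eq k)) h₀ hm⟩
  · obtain ⟨T, -, -, hT⟩ := hPQ
    have hQ : ∀ j k, Q.M j k = 0 := fun j k => by simp [← hT, hP]
    refine ⟨0, fun j _ => if j = ⟨0, P.npos⟩ then 1 else 0, fun j _ => ?_, fun _ => ?_,
      fun j k => ?_⟩
    · dsimp only
      split_ifs <;> norm_num
    · simp
    · simp [boxTimes, hQ, hP]

theorem PowerUniversal.suppSeparated {U : Vdc d} (hU : ∀ k, ∑ i, U.M i k = 1)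
    (h : PowerUniversal U) : SuppSeparated U := by
  intro a b hb hab
  by_contra hno
  let P : Vdc d :=
    { n := 2
      npos := Nat.two_pos
      M := fun i k => if i = 1 ∧ k = b then 0 else 1
      nonneg := fun i k => by split_ifs <;> norm_num
      mem := Or.inl ⟨0, fun k => by simp⟩
      dom := fun k i _ => by simp [Ne.symm hb] }
  let Q : Vdc d :=
    { n := 1
      npos := Nat.one_pos
      M := fun _ k => if k = b then 1 else 2
      nonneg := fun i k => by split_ifs <;> norm_num
      mem := Or.inl ⟨0, fun k => by split_ifs <;> norm_num⟩
      dom := fun k i _ => by split_ifs <;> norm_num }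
  have hPQ : maj P Q := ⟨fun _ _ => 1, fun _ _ => zero_le_one, fun i => by simp [Q], fun j k => by
    by_cases hk : k = b <;> simp [P, Q, hk, Fin.sum_univ_two]⟩
  obtain ⟨m, hm⟩ := h P Q hPQ
  have hle := hm.crossMass_le a b
  rw [crossMass_boxTimes, crossMass_boxPow, crossMass_eq_one hU hno, one_pow, mul_one] at hle
  simp [crossMass, P, Q, hab, Fin.sum_univ_two] at hle

theorem suppSeparated_iff (U : Vdc d) :
    SuppSeparated U ↔
      (∀ k : Fin d, {i | U.M i k.castSucc ≠ 0} ⊂ {i | U.M i (Fin.last d) ≠ 0}) ∧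
      (∀ k k' : Fin d, k ≠ k' →
        ¬ ({i | U.M i k.castSucc ≠ 0} ⊆ {i | U.M i k'.castSucc ≠ 0})) := by
  have key : ∀ a b : Fin (d + 1), (∃ i, U.M i a ≠ 0 ∧ U.M i b = 0) ↔
      ¬ ({i | U.M i a ≠ 0} ⊆ {i | U.M i b ≠ 0}) := fun a b => by
    simp
  constructor
  · intro h
    refine ⟨fun k => ⟨fun i hi => U.dom k i hi, ?_⟩, fun k k' hk => ?_⟩
    · exact (key _ _).mp (h _ _ (Fin.castSucc_lt_last k).ne (Fin.castSucc_lt_last k).ne')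
    · exact (key _ _).mp (h _ _ (Fin.castSucc_lt_last k').ne
        fun e => hk (Fin.castSucc_injective d e))
  · rintro ⟨h1, h2⟩ a b hb hab
    rw [key]
    obtain ⟨b, rfl⟩ := Fin.exists_castSucc_eq.mpr hb
    induction a using Fin.lastCases with
    | last => exact (h1 b).2
    | cast a => exact h2 a b fun e => hab (congrArg _ e)

theorem PhiAC_stdBasis (a b : Fin (d + 1)) (U : Vdc d) :
    PhiAC (stdBasis d a) {a, b} U = crossMass a b U := by
  rw [PhiAC, crossMass, Finset.sum_filter]
  refine Finset.sum_congr rfl fun i _ => ?_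
  have : ∏ k, U.M i k ^ stdBasis d a k = U.M i a := by
    rw [Finset.prod_eq_single a] <;> simp +contextual [stdBasis]
  rw [this]
  by_cases ha : U.M i a = 0 <;> by_cases hb : U.M i b = 0 <;> simp [ha, hb]

theorem exists_of_not_degPairDC {α : Fin (d + 1) → ℝ} {C : Finset (Fin (d + 1))}
    (hα : ∀ k, 0 ≤ α k) (hα1 : ∑ k, α k = 1) (hC : ∀ k, 0 < α k → k ∈ C)
    (hdeg : ¬ DegPairDC α C) : ∃ a b, b ∈ C ∧ b ≠ Fin.last d ∧ a ≠ b ∧ 0 < α a := by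
  by_contra! hno
  obtain ⟨a, ha⟩ : ∃ a, 0 < α a := by
    by_contra! h
    linarith [Finset.sum_nonpos fun k (_ : k ∈ Finset.univ) => h k]
  have hCsub : C ⊆ {a, Fin.last d} := fun b hb => by
    by_contra hne
    simp only [Finset.mem_insert, Finset.mem_singleton, not_or] at hne
    exact (hno a b hb hne.2 (Ne.symm hne.1)).not_gt ha
  have hzero : ∀ k, k ≠ a → α k = 0 := fun k hka => by
    by_contra hk
    have hk' : 0 < α k := lt_of_le_of_ne (hα k) (Ne.symm hk)
    have hkl : k = Fin.last d := by simpa [hka] using hCsub (hC k hk')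
    exact (hno k a (hC a ha) (fun h => hka (hkl.trans h.symm)) hka).not_gt hk'
  refine hdeg ⟨a, funext fun k => ?_, hCsub⟩
  by_cases hka : k = a
  · rw [Finset.sum_eq_single a (fun k _ => hzero k) (by simp)] at hα1
    simp [stdBasis, hka, hα1]
  · simp [stdBasis, hka, hzero k hka]

theorem PhiAC_lt_one {U : Vdc d} (hU : ∀ k, ∑ i, U.M i k = 1) (hs : SuppSeparated U)
    {α : Fin (d + 1) → ℝ} {C : Finset (Fin (d + 1))} (hα : ∀ k, 0 ≤ α k) (hα1 : ∑ k, α k = 1)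
    (hC : ∀ k, 0 < α k → k ∈ C) (hdeg : ¬ DegPairDC α C) : PhiAC α C U < 1 := by
  obtain ⟨a, b, hbC, hb, hab, ha⟩ := exists_of_not_degPairDC hα hα1 hC hdeg
  have hone : ∑ i, ∑ k, α k * U.M i k = 1 := by
    rw [Finset.sum_comm]
    simp_rw [← Finset.mul_sum, hU, mul_one, hα1]
  have h0 : ∀ i, 0 ≤ ∑ k, α k * U.M i k := fun i =>
    Finset.sum_nonneg fun k _ => mul_nonneg (hα k) (U.nonneg i k)
  rw [PhiAC, Finset.sum_filter, ← hone]
  obtain ⟨i, hia, hib⟩ := hs a b hb hab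
  refine Finset.sum_lt_sum (fun j _ => ?_) ⟨i, Finset.mem_univ i, ?_⟩
  · split_ifs
    · exact Real.geom_mean_le_arith_mean_weighted _ _ _ (fun k _ => hα k) hα1
        fun k _ => U.nonneg j k
    · exact h0 j
  · rw [if_neg fun h => h b hbC hib]
    refine Finset.sum_pos' (fun k _ => mul_nonneg (hα k) (U.nonneg i k)) ⟨a, Finset.mem_univ a, ?_⟩
    exact mul_pos ha (lt_of_le_of_ne (U.nonneg i a) (Ne.symm hia))

theorem one_lt_PhiDC {U : Vdc d} (hU : ∀ k, ∑ i, U.M i k = 1) (hs : SuppSeparated U)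
    (c : Fin d) {α : ℝ} (hα : 1 < α) : 1 < PhiDC α c U := by
  have hone : ∑ i, (α * U.M i c.castSucc - (α - 1) * U.M i (Fin.last d)) = 1 := by
    rw [Finset.sum_sub_distrib, ← Finset.mul_sum, ← Finset.mul_sum, hU, hU]
    ring
  rw [PhiDC, Finset.sum_filter]
  refine hone.symm.trans_lt ?_
  obtain ⟨i, hil, hic⟩ := hs (Fin.last d) c.castSucc (Fin.castSucc_lt_last c).ne
    (Fin.castSucc_lt_last c).ne'
  refine Finset.sum_lt_sum (fun j _ => ?_) ⟨i, Finset.mem_univ i, ?_⟩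
  · split_ifs with hj
    · have hy : 0 < U.M j (Fin.last d) := lt_of_le_of_ne (U.nonneg j _) (Ne.symm hj)
      have hx := U.nonneg j c.castSucc
      have hB := one_add_mul_self_le_rpow_one_add
        (s := U.M j c.castSucc / U.M j (Fin.last d) - 1)
        (by linarith [div_nonneg hx hy.le]) hα.le
      rw [add_sub_cancel, Real.div_rpow hx hy.le] at hB
      rw [Real.rpow_sub hy, Real.rpow_one]
      have := mul_le_mul_of_nonneg_left hB hy.le
      calc _ = U.M j (Fin.last d) *
            (1 + α * (U.M j c.castSucc / U.M j (Fin.last d) - 1)) := by field_simp; ring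
        _ ≤ _ := this
        _ = _ := by ring
    · have : U.M j c.castSucc = 0 := by
        by_contra h
        exact U.dom c j h (not_not.mp hj)
      simp [this, not_not.mp hj]
  · rw [if_pos hil, hic, Real.zero_rpow (by linarith)]
    have := lt_of_le_of_ne (U.nonneg i (Fin.last d)) (Ne.symm hil)
    nlinarith

theorem maxRatio_ne_one {U : Vdc d} (hU : ∀ k, ∑ i, U.M i k = 1) (hs : SuppSeparated U)
    (c : Fin d) : maxRatio c U ≠ 1 := by
  intro h1
  obtain ⟨i, hil, hic⟩ := hs (Fin.last d) c.castSucc (Fin.castSucc_lt_last c).ne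
    (Fin.castSucc_lt_last c).ne'
  rw [maxRatio, dif_pos ⟨i, hil⟩] at h1
  have hle : ∀ j, U.M j c.castSucc ≤ U.M j (Fin.last d) := fun j => by
    by_cases hj : U.M j (Fin.last d) = 0
    · have : U.M j c.castSucc = 0 := by
        by_contra h
        exact U.dom c j h hj
      rw [this, hj]
    · have := (Finset.sup'_le_iff _ _).mp h1.le j (by simp [hj])
      exact (div_le_one (lt_of_le_of_ne (U.nonneg j _) (Ne.symm hj))).mp this
  have hlt : ∑ j, U.M j c.castSucc < ∑ j, U.M j (Fin.last d) :=
    Finset.sum_lt_sum (fun j _ => hle j)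
      ⟨i, Finset.mem_univ i, hic ▸ lt_of_le_of_ne (U.nonneg i _) (Ne.symm hil)⟩
  rw [hU, hU] at hlt
  exact lt_irrefl _ hlt

theorem suppSeparated_of_PhiAC_ne_one {U : Vdc d} (hU : ∀ k, ∑ i, U.M i k = 1)
    (h : ∀ (α : Fin (d + 1) → ℝ) (C : Finset (Fin (d + 1))),
      (∀ k, 0 ≤ α k) → (∑ k, α k = 1) → (∀ k, 0 < α k → k ∈ C) →
      ¬ DegPairDC α C → PhiAC α C U ≠ 1) : SuppSeparated U := by
  intro a b hb hab
  by_contra hno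
  refine h (stdBasis d a) {a, b} (fun k => ?_) ?_ (fun k hk => ?_) ?_
    ((PhiAC_stdBasis a b U).trans (crossMass_eq_one hU hno))
  · unfold stdBasis
    split_ifs <;> norm_num
  · simp [stdBasis]
  · by_cases hka : k = a
    · simp [hka]
    · simp [stdBasis, hka] at hk
  · rintro ⟨k, hk, hsub⟩
    have hak : a = k := by
      by_contra hne
      simpa [stdBasis, hne] using congrFun hk a
    have hmem := hsub (show b ∈ ({a, b} : Finset _) by simp)
    simp [← hak, hb, Ne.symm hab] at hmem

theorem powerUniversal_iff_suppSeparated {U : Vdc d} (hU : ∀ k, ∑ i, U.M i k = 1) :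
    PowerUniversal U ↔ SuppSeparated U :=
  ⟨fun h => h.suppSeparated hU, fun h => h.powerUniversal hU⟩

end Vdc

/-- For `U ∈ V^d_{d.c.}` with probability-vector columns, the
following are equivalent: (i) `U` is power universal for `V^d_{d.c.}`; (ii) the support
of each non-last column is a proper subset of the support of the last column, and no
non-last column's support is contained in another non-last column's support;
(iii) every nondegenerate monotone homomorphism takes a value `≠ 1` at `U`
(`Φ_{α,C}` for nondegenerate `(α,C)`, `Φ_{α,c}` for `α > 1`, and the max-ratio
monotones). -/
theorem stmt14 (d : ℕ) (hd : 1 ≤ d) (U : Vdc d)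
    (hU : ∀ k, ∑ i, U.M i k = 1) :
    (PowerUniversal U ↔
      ((∀ k : Fin d,
          {i | U.M i k.castSucc ≠ 0} ⊂ {i | U.M i (Fin.last d) ≠ 0}) ∧
       (∀ k k' : Fin d, k ≠ k' →
          ¬ ({i | U.M i k.castSucc ≠ 0} ⊆ {i | U.M i k'.castSucc ≠ 0})))) ∧
    (PowerUniversal U ↔
      ((∀ (α : Fin (d + 1) → ℝ) (C : Finset (Fin (d + 1))),
          (∀ k, 0 ≤ α k) → (∑ k, α k = 1) → (∀ k, 0 < α k → k ∈ C) →
          ¬ DegPairDC α C → PhiAC α C U ≠ 1) ∧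
       (∀ (c : Fin d) (α : ℝ), 1 < α → PhiDC α c U ≠ 1) ∧
       (∀ c : Fin d, maxRatio c U ≠ 1))) := by
  rw [powerUniversal_iff_suppSeparated hU]
  refine ⟨suppSeparated_iff U, fun hs => ⟨?_, ?_, ?_⟩, fun h => ?_⟩
  · exact fun α C hα hα1 hC hdeg => (PhiAC_lt_one hU hs hα hα1 hC hdeg).ne
  · exact fun c α hα => (one_lt_PhiDC hU hs c hα).ne'
  · exact maxRatio_ne_one hU hs
  · exact suppSeparated_of_PhiAC_ne_one hU h.1
end
end
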